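/- Reduction Theorem (part i). Let K be an algebraically closed field of characteristic 0 and g = (K^m, φ₀) a finite-dimensional Lie algebra decomposed as g = R ⊕ N, where R is a Lie subalgebra acting semisimply on g via the adjoint representation and N = K^n is an ideal (e.g. g algebraic with nilpotent radical N and maximal reductive subalgebra R). Let φ₀' = φ₀|_{N×N}, D = {ad_{φ₀}(r)|_N : r ∈ R}, and let ī_q : H^q(N,N)^R → H^q(g,g) be the maps induced in cohomology by the extension-by-zero i(f) := f∘(p×⋯×p), p : g → N the projection. Assume ī₁ is surjective, ī₂ is bijective and ī₃ is injective. Then for every Noetherian complete local K-algebra A with maximal ideal 𝔪 and residue field K, the map 𝔍 sending an R-invariant deformation φ of φ₀' with base A to the bracket 𝔍(φ) on A⊗K^m given by 𝔍(φ)(r+x, s+y) = φ₀(r,s) + φ₀(r,y) + φ₀(x,s) + φ(x,y) (r,s ∈ A⊗R, x,y ∈ A⊗N) is well defined (𝔍(φ) is a deformation of φ₀ with base A), and it induces a bijection from the set of R-invariant deformations of φ₀' modulo G_n(A)^R onto the set of deformations of φ₀ modulo G_m(A). -/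

import Mathlib

section Stmt0

/-- Bilinearity of a raw map over a commutative ring. -/
def IsBilin (A : Type) [CommRing A] {M : Type} [AddCommGroup M] [Module A M]
    (f : M → M → M) : Prop :=
  (∀ (a : A) (x x' y : M), f (a • x + x') y = a • f x y + f x' y) ∧
  (∀ (a : A) (x y y' : M), f x (a • y + y') = a • f x y + f x y')

/-- Linearity of a raw map. -/
def IsLin (A : Type) [CommRing A] {M : Type} [AddCommGroup M] [Module A M]
    (L : M → M) : Prop :=
  ∀ (a : A) (x y : M), L (a • x + y) = a • L x + L y

/-- Trilinearity of a raw map. -/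
def IsTrilin (A : Type) [CommRing A] {M : Type} [AddCommGroup M] [Module A M]
    (f : M → M → M → M) : Prop :=
  (∀ (a : A) (x x' y z : M), f (a • x + x') y z = a • f x y z + f x' y z) ∧
  (∀ (a : A) (x y y' z : M), f x (a • y + y') z = a • f x y z + f x y' z) ∧
  (∀ (a : A) (x y z z' : M), f x y (a • z + z') = a • f x y z + f x y z')

/-- The Jacobi identity for a raw bracket. -/
def IsJac {M : Type} [AddCommGroup M] (f : M → M → M) : Prop :=
  ∀ x y z, f (f x y) z + f (f y z) x + f (f z x) y = 0

/-- Chevalley–Eilenberg differential `C¹ → C²` for the bracket `φ`. -/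
def d1 {M : Type} [AddCommGroup M] (φ : M → M → M) (L : M → M) : M → M → M :=
  fun x y => φ x (L y) - φ y (L x) - L (φ x y)

/-- Chevalley–Eilenberg differential `C² → C³` for the bracket `φ`. -/
def d2 {M : Type} [AddCommGroup M] (φ : M → M → M) (ψ : M → M → M) : M → M → M → M :=
  fun x y z =>
    φ x (ψ y z) - φ y (ψ x z) + φ z (ψ x y)
      - ψ (φ x y) z + ψ (φ x z) y - ψ (φ y z) x

/-- Chevalley–Eilenberg differential `C³ → C⁴` for the bracket `φ`. -/
def d3 {M : Type} [AddCommGroup M] (φ : M → M → M) (χ : M → M → M → M) :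
    M → M → M → M → M :=
  fun x y z w =>
    φ x (χ y z w) - φ y (χ x z w) + φ z (χ x y w) - φ w (χ x y z)
      - χ (φ x y) z w + χ (φ x z) y w - χ (φ x w) y z
      - χ (φ y z) x w + χ (φ y w) x z - χ (φ z w) x y

/-- Extension by zero `A^n → A^m` (first `n` coordinates). -/
def inclFun (A : Type) [CommRing A] (m n : ℕ) (w : Fin n → A) : Fin m → A :=
  fun k => if h : (k : ℕ) < n then w ⟨k, h⟩ else 0

/-- Restriction `A^m → A^n` to the first `n` coordinates. -/
def restFun (A : Type) [CommRing A] {m : ℕ} (n : ℕ) (hnm : n ≤ m) (v : Fin m → A) :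
    Fin n → A :=
  fun i => v (Fin.castLE hnm i)

/-- `id + W`, for a matrix `W` over `A`. -/
def matMap {A : Type} [CommRing A] {m : ℕ} (W : Fin m → Fin m → A) (x : Fin m → A) :
    Fin m → A :=
  fun k => x k + ∑ j : Fin m, W k j * x j

namespace RT

section filt
variable {A : Type} [CommRing A] (I : Ideal A)

/-- The `I`-adic filtration of a module. -/
def V (M : Type) [AddCommGroup M] [Module A M] (k : ℕ) : Submodule A M := I ^ k • ⊤

variable {M M' M'' : Type} [AddCommGroup M] [Module A M] [AddCommGroup M'] [Module A M']
  [AddCommGroup M''] [Module A M'']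

/-- Completeness and separatedness for the `I`-adic filtration. -/
structure Comp (I : Ideal A) (M : Type) [AddCommGroup M] [Module A M] : Prop where
  sep : ∀ x : M, (∀ k, x ∈ V I M k) → x = 0
  lim : ∀ f : ℕ → M, (∀ k, f (k + 1) - f k ∈ V I M k) → ∃ L, ∀ k, L - f k ∈ V I M k

variable {I}

lemma V_anti {j k : ℕ} (h : j ≤ k) {x : M} (hx : x ∈ V I M k) : x ∈ V I M j :=
  Submodule.smul_mono_left (Ideal.pow_le_pow_right h) hx

lemma V_zero (x : M) : x ∈ V I M 0 := by simp [V]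

lemma V_smul {j k : ℕ} {a : A} (ha : a ∈ I ^ j) {x : M} (hx : x ∈ V I M k) :
    a • x ∈ V I M (j + k) := by
  unfold V at *
  rw [pow_add, ← smul_eq_mul, Submodule.smul_assoc]
  exact Submodule.smul_mem_smul ha hx

lemma map_V' {j k : ℕ} (f : M →ₗ[A] M') (hf : ∀ x, f x ∈ V I M' j) {x : M} (hx : x ∈ V I M k) :
    f x ∈ V I M' (j + k) := by
  unfold V at hx
  induction hx using Submodule.smul_induction_on' with
  | smul a ha x _ => rw [map_smul, add_comm]; exact V_smul ha (hf x)
  | add x _ y _ h1 h2 => rw [map_add]; exact add_mem h1 h2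

lemma map_V {k : ℕ} (f : M →ₗ[A] M') {x : M} (hx : x ∈ V I M k) : f x ∈ V I M' k := by
  have := map_V' (j := 0) f (fun x => V_zero _) hx
  simpa using this

lemma bil_V {a b c : ℕ} (B : M →ₗ[A] M' →ₗ[A] M'') (hB : ∀ x y, B x y ∈ V I M'' a)
    {x : M} {y : M'} (hx : x ∈ V I M b) (hy : y ∈ V I M' c) : B x y ∈ V I M'' (a + b + c) := by
  refine map_V' (B x) (fun y => ?_) hy
  exact map_V' (B.flip y) (fun x => hB x y) hx

/-- version with target index -/
lemma bil_V' {a b c k : ℕ} (B : M →ₗ[A] M' →ₗ[A] M'') (hB : ∀ x y, B x y ∈ V I M'' a)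
    {x : M} {y : M'} (hx : x ∈ V I M b) (hy : y ∈ V I M' c) (h : k ≤ a + b + c) :
    B x y ∈ V I M'' k := V_anti h (bil_V B hB hx hy)

lemma V_sub_symm {k : ℕ} {x y : M} (h : x - y ∈ V I M k) : y - x ∈ V I M k := by
  rw [← neg_sub]; exact neg_mem h

lemma sub_V {k : ℕ} {x y : M} (h : x - y ∈ V I M k) (hy : y ∈ V I M k) : x ∈ V I M k := by
  have := add_mem h hy
  simpa using this

lemma Comp.eq (hM : Comp I M) {x y : M} (h : ∀ k, x - y ∈ V I M k) : x = y :=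
  sub_eq_zero.1 (hM.sep _ h)

lemma cauchy_le {f : ℕ → M} (hf : ∀ k, f (k + 1) - f k ∈ V I M k) {j k : ℕ} (h : j ≤ k) :
    f k - f j ∈ V I M j := by
  induction k, h using Nat.le_induction with
  | base => simp
  | succ k hk ih =>
    have := add_mem (V_anti hk (hf k)) ih
    simpa using this

lemma lin_lim (hM : Comp I M') (f : ℕ → M →ₗ[A] M')
    (hf : ∀ k x, f (k + 1) x - f k x ∈ V I M' k) :
    ∃ L : M →ₗ[A] M', ∀ k x, L x - f k x ∈ V I M' k := by
  choose L hL using fun x => hM.lim (fun k => f k x) (fun k => hf k x)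
  refine ⟨{ toFun := L, map_add' := ?_, map_smul' := ?_ }, fun k x => hL x k⟩
  · intro x y
    refine hM.eq fun k => ?_
    have := sub_mem (hL (x + y) k) (add_mem (hL x k) (hL y k))
    convert this using 1
    simp only [map_add]; abel
  · intro a x
    refine hM.eq fun k => ?_
    have := sub_mem (hL (a • x) k) ((V I M' k).smul_mem a (hL x k))
    convert this using 1
    simp only [map_smul, smul_sub, RingHom.id_apply]; abel

lemma bil_lim (hM : Comp I M'') (f : ℕ → M →ₗ[A] M' →ₗ[A] M'')
    (hf : ∀ k x y, f (k + 1) x y - f k x y ∈ V I M'' k) :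
    ∃ L : M →ₗ[A] M' →ₗ[A] M'', ∀ k x y, L x y - f k x y ∈ V I M'' k := by
  choose L hL using fun x => lin_lim hM (fun k => f k x) (fun k => hf k x)
  refine ⟨{ toFun := L, map_add' := ?_, map_smul' := ?_ }, fun k x => hL x k⟩
  · intro x y
    ext z
    refine hM.eq fun k => ?_
    have := sub_mem (hL (x + y) k z) (add_mem (hL x k z) (hL y k z))
    convert this using 1
    simp only [map_add, LinearMap.add_apply]; abel
  · intro a x
    ext z
    refine hM.eq fun k => ?_
    have := sub_mem (hL (a • x) k z) ((V I M'' k).smul_mem a (hL x k z))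
    convert this using 1
    simp only [map_smul, smul_sub, RingHom.id_apply, LinearMap.smul_apply]; abel

lemma pow_V {c : M →ₗ[A] M} (hc : ∀ x, c x ∈ V I M 1) (j : ℕ) (x : M) : (c ^ j) x ∈ V I M j := by
  induction j with
  | zero => exact V_zero _
  | succ j ih => rw [pow_succ', add_comm]; exact map_V' c hc ih

/-- maps congruent to the identity are bijective -/
lemma unip_bij (hM : Comp I M) (s : M →ₗ[A] M) (hs : ∀ x, s x - x ∈ V I M 1) :
    Function.Bijective s := by
  constructor
  · rw [injective_iff_map_eq_zero]
    intro x hx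
    have h1 : ∀ k, x ∈ V I M k := by
      intro k
      induction k with
      | zero => exact V_zero _
      | succ k ih =>
        have := map_V' (s - LinearMap.id) (fun x => by simpa using hs x) ih
        rw [add_comm]
        simpa [hx] using this
    exact hM.sep _ h1
  · intro y
    set c : M →ₗ[A] M := LinearMap.id - s with hc
    have hcV : ∀ x, c x ∈ V I M 1 := fun x => by
      simpa [hc] using V_sub_symm (hs x)
    obtain ⟨L, hL⟩ := hM.lim (fun k => ∑ j ∈ Finset.range k, (c ^ j) y) (fun k => by
      simpa [Finset.sum_range_succ] using pow_V hcV k y)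
    refine ⟨L, hM.eq fun k => ?_⟩
    have h2 : s (∑ j ∈ Finset.range k, (c ^ j) y) = y - (c ^ k) y := by
      have hs' : ∀ x, s x = x - c x := by intro x; simp [hc]
      rw [hs', map_sum]
      induction k with
      | zero => simp
      | succ k ih => 
        rw [Finset.sum_range_succ, Finset.sum_range_succ, pow_succ' c k]
        rw [add_sub_add_comm, ih]
        simp
    have h1 := map_V s (hL k)
    rw [map_sub, h2] at h1
    have := sub_mem h1 (pow_V hcV k y)
    convert this using 1
    abel

end filt
end RT

namespace RT
section expo
variable {K A : Type} [Field K] [CharZero K] [CommRing A] [Algebra K A] {I : Ideal A}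
variable {M : Type} [AddCommGroup M] [Module A M]

/-- divided powers -/
noncomputable def dp (K : Type) [Field K] [Algebra K A] (D : M →ₗ[A] M) (j : ℕ) : M →ₗ[A] M :=
  algebraMap K A ((j.factorial : K)⁻¹) • D ^ j

lemma dp_succ (D : M →ₗ[A] M) (j : ℕ) (x : M) :
    D (dp K D j x) = (j + 1) • dp K D (j + 1) x := by
  simp only [dp, LinearMap.smul_apply, map_smul]
  rw [pow_succ', Module.End.mul_apply, ← Nat.cast_smul_eq_nsmul A, smul_smul]
  congr 1
  have : ((j + 1 : ℕ) : A) = algebraMap K A ((j + 1 : ℕ) : K) := by simp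
  rw [this, ← map_mul]
  congr 1
  rw [Nat.factorial_succ]
  have h1 : ((j + 1 : ℕ) : K) ≠ 0 := Nat.cast_ne_zero.2 (by omega)
  have h2 : ((j.factorial : ℕ) : K) ≠ 0 := Nat.cast_ne_zero.2 (Nat.factorial_ne_zero _)
  push_cast at *
  field_simp

lemma nsmul_cancel (K : Type) [Field K] [CharZero K] [Algebra K A] (j : ℕ) {x y : M}
    (h : (j + 1) • x = (j + 1) • y) : x = y := by
  have h1 : ((j + 1 : ℕ) : K) ≠ 0 := Nat.cast_ne_zero.2 (by omega)
  have h3 : ∀ z : M, algebraMap K A (((j + 1 : ℕ) : K)⁻¹) • ((j + 1) • z) = z := by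
    intro z
    rw [← Nat.cast_smul_eq_nsmul A, smul_smul]
    have : ((j + 1 : ℕ) : A) = algebraMap K A ((j + 1 : ℕ) : K) := by simp
    rw [this, ← map_mul, inv_mul_cancel₀ h1]
    simp
  rw [← h3 x, h, h3]

lemma dp_leib (B : M →ₗ[A] M →ₗ[A] M) (D : M →ₗ[A] M)
    (hD : ∀ x y, D (B x y) = B (D x) y + B x (D y)) (j : ℕ) (x y : M) :
    dp K D j (B x y) = ∑ p ∈ Finset.HasAntidiagonal.antidiagonal j, B (dp K D p.1 x) (dp K D p.2 y) := by
  induction j with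
  | zero => simp [dp]
  | succ j ih =>
    apply nsmul_cancel (A := A) K j
    rw [← dp_succ, ih, map_sum]
    simp only [hD, dp_succ, Finset.sum_add_distrib, map_nsmul, LinearMap.smul_apply]
    rw [Finset.smul_sum]
    have h1 : ∀ p ∈ Finset.HasAntidiagonal.antidiagonal (j + 1),
        (j + 1) • B (dp K D p.1 x) (dp K D p.2 y) =
        p.1 • B (dp K D p.1 x) (dp K D p.2 y) + p.2 • B (dp K D p.1 x) (dp K D p.2 y) := by
      intro p hp
      rw [← add_smul, Finset.HasAntidiagonal.mem_antidiagonal.1 hp]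
    rw [Finset.sum_congr rfl h1, Finset.sum_add_distrib]
    congr 1
    · rw [Finset.Nat.sum_antidiagonal_succ]
      simp
    · rw [Finset.Nat.sum_antidiagonal_succ']
      simp

lemma dp_V {D : M →ₗ[A] M} {k : ℕ} (hk : 1 ≤ k) (hD : ∀ x, D x ∈ V I M k) (j : ℕ) (x : M) :
    dp K D j x ∈ V I M j := by
  refine (V I M j).smul_mem _ (pow_V (fun x => V_anti hk (hD x)) j x)

lemma exp_aut (K : Type) [Field K] [CharZero K] [Algebra K A] (hM : Comp I M)
    (B : M →ₗ[A] M →ₗ[A] M) (D : M →ₗ[A] M)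
    (hD : ∀ x y, D (B x y) = B (D x) y + B x (D y)) {k : ℕ} (hk : 1 ≤ k)
    (hDV : ∀ x, D x ∈ V I M k) :
    ∃ e : M →ₗ[A] M, (∀ x y, B (e x) (e y) = e (B x y)) ∧
      ∀ x, e x - (x + D x) ∈ V I M (k + 1) := by
  have hdp : ∀ j x, dp K D j x ∈ V I M j := dp_V hk hDV
  obtain ⟨e, he⟩ := lin_lim hM (fun k => ∑ j ∈ Finset.range k, dp K D j) (fun k x => by
    simpa [Finset.sum_range_succ] using hdp k x)
  refine ⟨e, fun x y => hM.eq fun N => ?_, fun x => ?_⟩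
  · have h1 := he N (B x y)
    set T : M →ₗ[A] M := ∑ j ∈ Finset.range N, dp K D j with hT
    have h2 : B (e x) (e y) - B (T x) (T y) ∈ V I M N := by
      have a1 : B (e x - T x) (e y) ∈ V I M N := map_V (B.flip (e y)) (he N x)
      have a2 : B (T x) (e y - T y) ∈ V I M N := map_V (B (T x)) (he N y)
      have := add_mem a1 a2
      simpa using this
    have h3 : B (T x) (T y) - T (B x y) ∈ V I M N := by
      have e1 : B (T x) (T y) = ∑ p ∈ Finset.range N ×ˢ Finset.range N,
          B (dp K D p.1 x) (dp K D p.2 y) := by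
        simp only [hT, LinearMap.sum_apply, map_sum, Finset.sum_product]
        exact Finset.sum_comm
      have e2 : T (B x y) = ∑ p ∈ (Finset.range N ×ˢ Finset.range N).filter
          (fun p => p.1 + p.2 < N), B (dp K D p.1 x) (dp K D p.2 y) := by
        rw [← Finset.sum_fiberwise_of_maps_to (t := Finset.range N) (g := fun p => p.1 + p.2)]
        · simp only [hT, LinearMap.sum_apply]
          refine Finset.sum_congr rfl fun j hj => ?_
          rw [dp_leib B D hD]
          refine Finset.sum_congr ?_ fun _ _ => rfl
          ext p
          simp only [Finset.HasAntidiagonal.mem_antidiagonal, Finset.mem_filter, Finset.mem_product,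
            Finset.mem_range] at *
          omega
        · intro p hp
          simp only [Finset.mem_filter] at hp
          simpa using hp.2
      rw [e1, e2, ← Finset.sum_filter_add_sum_filter_not (Finset.range N ×ˢ Finset.range N)
        (fun p => p.1 + p.2 < N), add_sub_cancel_left]
      refine sum_mem fun p hp => ?_
      simp only [Finset.mem_filter, not_lt] at hp
      exact bil_V' B (a := 0) (fun _ _ => V_zero _) (hdp p.1 x) (hdp p.2 y) (by omega)
    have := sub_mem (add_mem h2 h3) h1
    convert this using 1
    abel
  · have h1 := he (k + 1) x
    have h2 : (∑ j ∈ Finset.range (k + 1), dp K D j x) - (x + D x) ∈ V I M (k + 1) := by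
      obtain ⟨k, rfl⟩ : ∃ k', k = k' + 1 := ⟨k - 1, by omega⟩
      rw [Finset.sum_range_succ', Finset.sum_range_succ']
      have : (∑ j ∈ Finset.range k, dp K D (j + 1 + 1) x) ∈ V I M (k + 1 + 1) := by
        refine sum_mem fun j _ => ?_
        refine (V I M _).smul_mem _ ?_
        rw [pow_succ, Module.End.mul_apply, pow_succ', Module.End.mul_apply]
        exact V_anti (by omega) (map_V' D hDV (map_V (D ^ j) (hDV x)))
      convert this using 1
      simp [dp]
      abel
    have := add_mem h1 h2
    simpa using this

end expo
end RT

namespace RT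
section alg
variable {A : Type} [CommRing A] {I : Ideal A}
variable {M : Type} [AddCommGroup M] [Module A M]

/-- bilinear brackets -/
abbrev Bil (A M : Type) [CommRing A] [AddCommGroup M] [Module A M] := M →ₗ[A] M →ₗ[A] M

/-- Jacobiator -/
def jc (f : M → M → M) (x y z : M) : M := f (f x y) z + f (f y z) x + f (f z x) y

lemma anti {B : Bil A M} (h : ∀ x, B x x = 0) (x y : M) : B x y = - B y x := by
  have := h (x + y)
  simp only [map_add, LinearMap.add_apply, h, zero_add, add_zero] at this
  exact eq_neg_of_add_eq_zero_right this

lemma jc_expand {Φ Θ : Bil A M} (h : ∀ x, Φ x x = 0) (h' : ∀ x, Θ x x = 0) (x y z : M) :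
    jc (fun a b => (Φ + Θ) a b) x y z = jc (fun a b => Φ a b) x y z
      - d2 (fun a b => Φ a b) (fun a b => Θ a b) x y z + jc (fun a b => Θ a b) x y z := by
  simp only [jc, d2, LinearMap.add_apply, map_add]
  rw [anti h x (Θ y z), anti h y (Θ x z), anti h z (Θ x y), anti h' x z, anti h x z]
  simp only [map_neg, LinearMap.neg_apply]
  abel

lemma bianchi {φ : Bil A M} (h : ∀ x, φ x x = 0) (x y z w : M) :
    d3 (fun a b => φ a b) (jc (fun a b => φ a b)) x y z w = 0 := by
  simp only [jc, d3, map_add]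
  have e := anti h
  rw [e x (φ (φ y z) w), e x (φ (φ z w) y), e x (φ (φ w y) z),
    e y (φ (φ x z) w), e y (φ (φ z w) x), e y (φ (φ w x) z),
    e z (φ (φ x y) w), e z (φ (φ y w) x), e z (φ (φ w x) y),
    e w (φ (φ x y) z), e w (φ (φ y z) x), e w (φ (φ z x) y),
    e w (φ x y), e w (φ x z), e z (φ x w), e w (φ y z), e z (φ y w), e y (φ z w),
    e (φ y z) (φ x w), e (φ y w) (φ x z), e (φ z w) (φ x y),
    e w x, e w y, e z x]
  simp only [map_neg, LinearMap.neg_apply, neg_neg]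
  abel

lemma jc_self {φ : Bil A M} (h : ∀ x, φ x x = 0) (x y z : M) (hx : x = y ∨ y = z ∨ x = z) :
    jc (fun a b => φ a b) x y z = 0 := by
  rcases hx with rfl | rfl | rfl
  · simp only [jc, h, map_zero, LinearMap.zero_apply, zero_add]
    rw [anti h z x]; simp
  · simp only [jc, h, map_zero, LinearMap.zero_apply]
    rw [anti h y x]; simp
  · simp only [jc, h, map_zero, LinearMap.zero_apply]
    rw [anti h y x]; simp

lemma gauge {Φ Ψ : Bil A M} (hΦ : ∀ x, Φ x x = 0)
    (hd : ∀ x y, Ψ x y - Φ x y ∈ V I M 1) (Λ : M →ₗ[A] M) {k : ℕ} (hk : 1 ≤ k)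
    (hΛ : ∀ x, Λ x ∈ V I M k) (x y : M) :
    Ψ (x - Λ x) (y - Λ y) - (Ψ x y - Λ (Ψ x y)) + d1 (fun a b => Φ a b) Λ x y
      ∈ V I M (k + 1) := by
  have hd' : ∀ x y, (Ψ - Φ) x y ∈ V I M 1 := by simpa using hd
  have h1 : Ψ (Λ x) (Λ y) ∈ V I M (k + 1) :=
    bil_V' Ψ (a := 0) (fun _ _ => V_zero _) (hΛ x) (hΛ y) (by omega)
  have h2 : (Ψ - Φ) (Λ x) y ∈ V I M (k + 1) := bil_V' _ hd' (hΛ x) (V_zero y) (by omega)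
  have h3 : (Ψ - Φ) x (Λ y) ∈ V I M (k + 1) := bil_V' _ hd' (V_zero x) (hΛ y) (by omega)
  have h4 : Λ ((Ψ - Φ) x y) ∈ V I M (k + 1) := map_V' _ hΛ (hd' x y)
  have := add_mem (sub_mem (sub_mem h1 h2) h3) h4
  convert this using 1
  simp only [d1, map_sub, LinearMap.sub_apply]
  rw [anti hΦ y (Λ x)]
  abel

lemma d2_V {Φ Θ : Bil A M} {a b k : ℕ} (hΦ : ∀ x y, Φ x y ∈ V I M a) (hΘ : ∀ x y, Θ x y ∈ V I M b)
    (hk : k ≤ a + b) (x y z : M) :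
    d2 (fun a b => Φ a b) (fun a b => Θ a b) x y z ∈ V I M k := by
  have l : ∀ x y z, Φ x (Θ y z) ∈ V I M k := fun x y z =>
    bil_V' Φ hΦ (V_zero x) (hΘ y z) (by omega)
  have r : ∀ x y z, Θ (Φ x y) z ∈ V I M k := fun x y z =>
    bil_V' Θ hΘ (hΦ x y) (V_zero z) (by omega)
  exact sub_mem (add_mem (sub_mem (add_mem (sub_mem (l _ _ _) (l _ _ _)) (l _ _ _)) (r _ _ _))
    (r _ _ _)) (r _ _ _)

lemma jc_V {Θ : Bil A M} {b k : ℕ} (hΘ : ∀ x y, Θ x y ∈ V I M b)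
    (hk : k ≤ b + b) (x y z : M) : jc (fun a b => Θ a b) x y z ∈ V I M k := by
  have r : ∀ x y z, Θ (Θ x y) z ∈ V I M k := fun x y z =>
    bil_V' Θ hΘ (hΘ x y) (V_zero z) (by omega)
  exact add_mem (add_mem (r _ _ _) (r _ _ _)) (r _ _ _)

end alg

/-- The decomposed Lie algebra over `A`. -/
structure Setup (A E N : Type) [CommRing A] [AddCommGroup E] [Module A E] [AddCommGroup N]
    [Module A N] where
  Φ : Bil A E
  Φ' : Bil A N
  inc : N →ₗ[A] E
  res : E →ₗ[A] N
  ad : E →ₗ[A] N →ₗ[A] N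
  res_inc : ∀ x, res (inc x) = x
  ad_inc : ∀ x, ad (inc x) = 0
  alt : ∀ x, Φ x x = 0
  alt' : ∀ x, Φ' x x = 0
  jac : ∀ x y z, jc (fun a b => Φ a b) x y z = 0
  res_Φ : ∀ u v, res (Φ u v) = Φ' (res u) (res v) + ad u (res v) - ad v (res u)
  Φ_inc : ∀ u x, Φ u (inc x) = inc (ad u x + Φ' (res u) x)

namespace Setup
variable {A E N : Type} [CommRing A] [AddCommGroup E] [Module A E] [AddCommGroup N]
    [Module A N] (S : Setup A E N) {I : Ideal A}

def Inv1 (l : N →ₗ[A] N) : Prop := ∀ u x, S.ad u (l x) = l (S.ad u x)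
def Inv2 (f : Bil A N) : Prop := ∀ u x y, S.ad u (f x y) = f (S.ad u x) y + f x (S.ad u y)

def i1 (l : N →ₗ[A] N) : E →ₗ[A] E := S.inc ∘ₗ l ∘ₗ S.res
def i2 (f : Bil A N) : Bil A E := (f.compl₁₂ S.res S.res).compr₂ S.inc
def J (φ : Bil A N) : Bil A E := S.Φ + S.i2 (φ - S.Φ')

@[simp] lemma i1_apply (l : N →ₗ[A] N) (u : E) : S.i1 l u = S.inc (l (S.res u)) := rfl
@[simp] lemma i2_apply (f : Bil A N) (u v : E) : S.i2 f u v = S.inc (f (S.res u) (S.res v)) := rfl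

lemma ΦN (x y : N) : S.Φ (S.inc x) (S.inc y) = S.inc (S.Φ' x y) := by
  rw [S.Φ_inc, S.ad_inc, S.res_inc]; simp

lemma inc_inj : Function.Injective S.inc := Function.LeftInverse.injective S.res_inc

lemma jac' (x y z : N) : jc (fun a b => S.Φ' a b) x y z = 0 := by
  apply S.inc_inj
  have := S.jac (S.inc x) (S.inc y) (S.inc z)
  simp only [jc, ΦN] at this
  simpa [jc] using this

lemma invΦ' : S.Inv2 S.Φ' := by
  intro u x y
  apply S.inc_inj
  have := S.jac u (S.inc x) (S.inc y)
  simp only [jc] at this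
  rw [S.ΦN, anti S.alt (S.inc y) u, anti S.alt _ u] at this
  simp only [S.Φ_inc, map_add, map_neg, LinearMap.add_apply, LinearMap.neg_apply, S.ad_inc,
    S.res_inc, LinearMap.zero_apply, map_zero, zero_add] at this
  have h2 := S.jac' (S.res u) x y
  simp only [jc] at h2
  rw [anti S.alt' y (S.res u), anti S.alt' _ (S.res u)] at h2
  have h3 := congrArg S.inc h2
  simp only [map_add, map_neg, map_zero, LinearMap.neg_apply] at h3
  rw [anti S.alt' x (S.ad u y)]
  simp only [map_add, map_neg]
  rw [← sub_eq_zero]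
  rw [← sub_eq_zero] at this h3
  have h4 := congrArg₂ (· - ·) this h3
  simp only [sub_zero, sub_self] at h4
  rw [← neg_eq_zero, ← h4]
  abel

lemma inv2_add {f g : Bil A N} (hf : S.Inv2 f) (hg : S.Inv2 g) : S.Inv2 (f + g) := by
  intro u x y
  simp only [LinearMap.add_apply, map_add, hf u x y, hg u x y]; abel

lemma inv2_sub {f g : Bil A N} (hf : S.Inv2 f) (hg : S.Inv2 g) : S.Inv2 (f - g) := by
  intro u x y
  simp only [LinearMap.sub_apply, map_sub, hf u x y, hg u x y]; abel

lemma d1_i {l : N →ₗ[A] N} (hl : S.Inv1 l) (u v : E) :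
    d1 (fun a b => S.Φ a b) (S.i1 l) u v
      = S.inc (d1 (fun a b => S.Φ' a b) l (S.res u) (S.res v)) := by
  simp only [d1, i1_apply, S.Φ_inc, S.res_Φ, hl u, hl v, map_add, map_sub]
  abel

lemma d2_i {f : Bil A N} (hf : S.Inv2 f) (ha : ∀ x, f x x = 0) (u v w : E) :
    d2 (fun a b => S.Φ a b) (fun a b => S.i2 f a b) u v w
      = S.inc (d2 (fun a b => S.Φ' a b) (fun a b => f a b) (S.res u) (S.res v) (S.res w)) := by
  simp only [d2, i2_apply, S.Φ_inc, S.res_Φ, hf u, hf v, hf w, map_add, map_sub,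
    LinearMap.add_apply, LinearMap.sub_apply]
  rw [anti ha (S.res v) (S.ad u (S.res w)), anti ha (S.res u) (S.ad v (S.res w)),
    anti ha (S.res u) (S.ad w (S.res v))]
  simp only [map_neg]
  abel

lemma jc_i (f : Bil A N) (u v w : E) :
    jc (fun a b => S.i2 f a b) u v w
      = S.inc (jc (fun a b => f a b) (S.res u) (S.res v) (S.res w)) := by
  simp only [jc, i2_apply, S.res_inc, map_add]

lemma i2_alt {f : Bil A N} (ha : ∀ x, f x x = 0) (u : E) : S.i2 f u u = 0 := by
  simp [ha]

lemma J_alt {φ : Bil A N} (ha : ∀ x, φ x x = 0) (u : E) : S.J φ u u = 0 := by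
  simp [J, ha, S.alt, S.alt']

lemma jc_J {φ : Bil A N} (hf : S.Inv2 φ) (ha : ∀ x, φ x x = 0) (u v w : E) :
    jc (fun a b => S.J φ a b) u v w
      = S.inc (jc (fun a b => φ a b) (S.res u) (S.res v) (S.res w)) := by
  have hb : ∀ x, (φ - S.Φ') x x = 0 := by intro x; simp [ha, S.alt']
  have h1 := jc_expand (Φ := S.Φ) (Θ := S.i2 (φ - S.Φ')) S.alt (S.i2_alt hb) u v w
  have h2 := jc_expand (Φ := S.Φ') (Θ := (φ - S.Φ')) S.alt' hb (S.res u) (S.res v) (S.res w)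
  rw [add_sub_cancel] at h2
  unfold J
  rw [h1, S.jac, S.d2_i (S.inv2_sub hf S.invΦ') hb, jc_i, h2, S.jac']
  simp

/-- extension of a group element -/
def ig (t : N →ₗ[A] N) : E →ₗ[A] E := LinearMap.id + S.i1 (t - LinearMap.id)

lemma ig_apply (t : N →ₗ[A] N) (u : E) : S.ig t u = u + S.inc (t (S.res u) - S.res u) := rfl

lemma res_ig (t : N →ₗ[A] N) (u : E) : S.res (S.ig t u) = t (S.res u) := by
  simp [ig_apply, S.res_inc]

lemma J_ig {t : N →ₗ[A] N} (ht : S.Inv1 t) (φ φ' : Bil A N)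
    (h : ∀ x y, φ' (t x) (t y) = t (φ x y)) (u v : E) :
    S.J φ' (S.ig t u) (S.ig t v) = S.ig t (S.J φ u v) := by
  have e1 : ∀ x v, S.Φ (S.inc x) v = - S.inc (S.ad v x + S.Φ' (S.res v) x) := by
    intro x v; rw [anti S.alt, S.Φ_inc]
  simp only [J, LinearMap.add_apply, i2_apply, res_ig]
  simp only [LinearMap.sub_apply, h]
  simp only [ig_apply, map_add, LinearMap.add_apply, map_sub, LinearMap.sub_apply, S.ΦN,
    S.Φ_inc, e1, S.res_Φ, S.res_inc, ht u, ht v]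
  rw [anti S.alt' (S.res v) (t (S.res u)), anti S.alt' (S.res v) (S.res u)]
  simp only [map_neg]
  abel

lemma ig_V {t : N →ₗ[A] N} {k : ℕ} (ht : ∀ x, t x - x ∈ V I N k) (u : E) :
    S.ig t u - u ∈ V I E k := by
  rw [ig_apply, add_sub_cancel_left]
  exact map_V _ (ht _)

lemma J_V {φ : Bil A N} {k : ℕ} (h : ∀ x y, φ x y - S.Φ' x y ∈ V I N k) (u v : E) :
    S.J φ u v - S.Φ u v ∈ V I E k := by
  simp only [J, LinearMap.add_apply, add_sub_cancel_left, i2_apply]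
  exact map_V _ (h _ _)

end Setup
end RT

namespace RT
namespace Setup
variable {A E N : Type} [CommRing A] [AddCommGroup E] [Module A E] [AddCommGroup N]
    [Module A N] (S : Setup A E N) (I : Ideal A)

/-- lifted form of surjectivity in degree one -/
def L1 : Prop := ∀ (k : ℕ) (c : E →ₗ[A] E), (∀ x, c x ∈ V I E k) →
  (∀ x y, d1 (fun a b => S.Φ a b) c x y ∈ V I E (k + 1)) →
  ∃ (w : N →ₗ[A] N) (u : E), S.Inv1 w ∧ (∀ x, w x ∈ V I N k) ∧ u ∈ V I E k ∧
    ∀ x, c x - (S.i1 w x + S.Φ x u) ∈ V I E (k + 1)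

/-- lifted form of injectivity in degree two -/
def L2i : Prop := ∀ (k : ℕ) (ψ : Bil A N), (∀ x y, ψ x y ∈ V I N k) → (∀ x, ψ x x = 0) →
  S.Inv2 ψ →
  (∀ x y z, d2 (fun a b => S.Φ' a b) (fun a b => ψ a b) x y z ∈ V I N (k + 1)) →
  (∃ Λ : E →ₗ[A] E, ∀ u v, S.i2 ψ u v - d1 (fun a b => S.Φ a b) Λ u v ∈ V I E (k + 1)) →
  ∃ l : N →ₗ[A] N, S.Inv1 l ∧ (∀ x, l x ∈ V I N k) ∧
    ∀ x y, ψ x y - d1 (fun a b => S.Φ' a b) l x y ∈ V I N (k + 1)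

/-- lifted form of surjectivity in degree two -/
def L2s : Prop := ∀ (k : ℕ) (Ψ : Bil A E), (∀ x y, Ψ x y ∈ V I E k) → (∀ x, Ψ x x = 0) →
  (∀ x y z, d2 (fun a b => S.Φ a b) (fun a b => Ψ a b) x y z ∈ V I E (k + 1)) →
  ∃ ψ : Bil A N, (∀ x y, ψ x y ∈ V I N k) ∧ (∀ x, ψ x x = 0) ∧ S.Inv2 ψ ∧
    ∃ Λ : E →ₗ[A] E, (∀ x, Λ x ∈ V I E k) ∧
      ∀ u v, Ψ u v - (S.i2 ψ u v + d1 (fun a b => S.Φ a b) Λ u v) ∈ V I E (k + 1)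

/-- lifted form of injectivity in degree three -/
def L3i : Prop := ∀ (k : ℕ) (φ : Bil A N) (Θ : Bil A E), (∀ x, φ x x = 0) → S.Inv2 φ →
  (∀ x, Θ x x = 0) →
  (∀ x y z, jc (fun a b => φ a b) x y z ∈ V I N k) →
  (∀ x y z w, d3 (fun a b => S.Φ' a b) (jc (fun a b => φ a b)) x y z w ∈ V I N (k + 1)) →
  (∀ u v w, S.inc (jc (fun a b => φ a b) (S.res u) (S.res v) (S.res w))
    - d2 (fun a b => S.Φ a b) (fun a b => Θ a b) u v w ∈ V I E (k + 1)) →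
  ∃ ψ : Bil A N, (∀ x y, ψ x y ∈ V I N k) ∧ (∀ x, ψ x x = 0) ∧ S.Inv2 ψ ∧
    ∀ x y z, jc (fun a b => φ a b) x y z
      - d2 (fun a b => S.Φ' a b) (fun a b => ψ a b) x y z ∈ V I N (k + 1)

variable {I}

lemma d3_V {φ : Bil A N} {k : ℕ} (h1 : ∀ x y, φ x y - S.Φ' x y ∈ V I N 1)
    (ha : ∀ x, φ x x = 0)
    (h2 : ∀ x y z, jc (fun a b => φ a b) x y z ∈ V I N k) (x y z w : N) :
    d3 (fun a b => S.Φ' a b) (jc (fun a b => φ a b)) x y z w ∈ V I N (k + 1) := by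
  set θ := φ - S.Φ' with hθ
  have h1' : ∀ x y, θ x y ∈ V I N 1 := by simpa [hθ] using h1
  have hb := bianchi ha x y z w
  -- the Jacobiator as a linear map in its first slot
  let jl : N → N → N →ₗ[A] N := fun b c =>
    { toFun := fun a => jc (fun a b => φ a b) a b c
      map_add' := by intro p q; simp only [jc, map_add, LinearMap.add_apply]; abel
      map_smul' := by
        intro p q
        simp only [jc, map_smul, LinearMap.smul_apply, RingHom.id_apply, smul_add] }
  have jV : ∀ a b c d, jc (fun a b => φ a b) (θ a b) c d ∈ V I N (k + 1) := by
    intro a b c d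
    exact map_V' (jl c d) (fun x => h2 x c d) (h1' a b)
  have lV : ∀ a b c d, θ a (jc (fun a b => φ a b) b c d) ∈ V I N (k + 1) := by
    intro a b c d
    exact bil_V' θ h1' (V_zero a) (h2 b c d) (by omega)
  have hs : ∀ a b c d, jc (fun a b => φ a b) (S.Φ' a b) c d =
      jc (fun a b => φ a b) (φ a b) c d - jc (fun a b => φ a b) (θ a b) c d := by
    intro a b c d
    have := map_sub (jl c d) (φ a b) (θ a b)
    have e : φ a b - θ a b = S.Φ' a b := by simp [hθ]
    rw [e] at this
    exact this
  have hs' : ∀ a b, S.Φ' a b = φ a b - θ a b := by intro a b; simp [hθ]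
  have key : d3 (fun a b => S.Φ' a b) (jc (fun a b => φ a b)) x y z w =
      d3 (fun a b => φ a b) (jc (fun a b => φ a b)) x y z w -
      d3 (fun a b => θ a b) (jc (fun a b => φ a b)) x y z w := by
    simp only [d3, hs]
    simp only [hs']
    abel
  rw [key, hb, zero_sub]
  refine neg_mem ?_
  simp only [d3]
  exact sub_mem (add_mem (sub_mem (sub_mem (add_mem (sub_mem (sub_mem (add_mem (sub_mem (lV _ _ _ _)
    (lV _ _ _ _)) (lV _ _ _ _)) (lV _ _ _ _)) (jV _ _ _ _)) (jV _ _ _ _)) (jV _ _ _ _))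
    (jV _ _ _ _)) (jV _ _ _ _)) (jV _ _ _ _)

/-- inductive state for surjectivity -/
def PS (I : Ideal A) (Ψ : Bil A E) (k : ℕ) (p : Bil A N × (E →ₗ[A] E)) : Prop :=
  (∀ x, p.1 x x = 0) ∧ S.Inv2 p.1 ∧ (∀ x y, p.1 x y - S.Φ' x y ∈ V I N 1) ∧
  (∀ x, p.2 x - x ∈ V I E 1) ∧ ∀ x y, Ψ (p.2 x) (p.2 y) - p.2 (S.J p.1 x y) ∈ V I E k

lemma stepS (hE : Comp I E) (h2 : S.L2s I) (h3 : S.L3i I) (Ψ : Bil A E)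
    (hΨa : ∀ x, Ψ x x = 0) (hΨj : ∀ x y z, jc (fun a b => Ψ a b) x y z = 0)
    (k : ℕ) (hk : 1 ≤ k) (p : Bil A N × (E →ₗ[A] E)) (hp : S.PS I Ψ k p) :
    ∃ q : Bil A N × (E →ₗ[A] E), S.PS I Ψ (k + 1) q ∧
      (∀ x y, q.1 x y - p.1 x y ∈ V I N k) ∧ (∀ x, q.2 x - p.2 x ∈ V I E k) := by
  obtain ⟨φ, s⟩ := p
  obtain ⟨ha, hi, hd, hs, hc⟩ := hp
  simp only at *
  have hbij := unip_bij hE s hs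
  let σ : E ≃ₗ[A] E := LinearEquiv.ofBijective s hbij
  have hσ : ∀ x, σ x = s x := fun x => rfl
  let Ψ1 : Bil A E := (Ψ.compl₁₂ s s).compr₂ σ.symm.toLinearMap
  have hΨ1 : ∀ x y, s (Ψ1 x y) = Ψ (s x) (s y) := by
    intro x y
    rw [← hσ]
    exact σ.apply_symm_apply _
  have hsinj : Function.Injective s := hbij.1
  have hΨ1a : ∀ x, Ψ1 x x = 0 := by
    intro x; apply hsinj; rw [hΨ1, hΨa, map_zero]
  have hΨ1j : ∀ x y z, jc (fun a b => Ψ1 a b) x y z = 0 := by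
    intro x y z
    apply hsinj
    have := hΨj (s x) (s y) (s z)
    simp only [jc] at this ⊢
    simp only [map_add, hΨ1, map_zero, this]
  set Θ : Bil A E := Ψ1 - S.J φ with hΘ
  have hΘV : ∀ x y, Θ x y ∈ V I E k := by
    intro x y
    have := map_V σ.symm.toLinearMap (hc x y)
    rw [← hΨ1, ← hσ, ← hσ] at this
    simpa [hΘ] using this
  have hΘa : ∀ x, Θ x x = 0 := by
    intro x; simp only [hΘ, LinearMap.sub_apply, hΨ1a, S.J_alt ha, sub_zero]
  have hJV := S.J_V hd
  -- obstruction
  have hob : ∀ u v w, S.inc (jc (fun a b => φ a b) (S.res u) (S.res v) (S.res w))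
      - d2 (fun a b => S.Φ a b) (fun a b => Θ a b) u v w ∈ V I E (k + 1) := by
    intro u v w
    have e := jc_expand (Φ := S.J φ) (Θ := Θ) (S.J_alt ha) hΘa u v w
    have e' : S.J φ + Θ = Ψ1 := by simp [hΘ]
    rw [e', hΨ1j, S.jc_J hi ha] at e
    have t1 := jc_V hΘV (show k + 1 ≤ k + k by omega) u v w
    have t2 := d2_V (Φ := S.J φ - S.Φ) (Θ := Θ) (a := 1) (b := k) (k := k + 1)
      (by simpa using hJV) hΘV (by omega) u v w
    have := sub_mem t2 t1
    convert this using 1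
    have e2 : d2 (fun a b => (S.J φ - S.Φ) a b) (fun a b => Θ a b) u v w =
      d2 (fun a b => S.J φ a b) (fun a b => Θ a b) u v w -
      d2 (fun a b => S.Φ a b) (fun a b => Θ a b) u v w := by
      simp only [d2, LinearMap.sub_apply, map_sub]; abel
    rw [e2, ← sub_eq_zero]
    rw [eq_comm] at e
    rw [← e]
    abel
  have hχV : ∀ x y z, jc (fun a b => φ a b) x y z ∈ V I N k := by
    intro x y z
    have t1 := V_anti (Nat.le_succ k) (hob (S.inc x) (S.inc y) (S.inc z))
    have t2 := d2_V (Φ := S.Φ) (Θ := Θ) (a := 0) (b := k) (k := k) (fun _ _ => V_zero _) hΘV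
      (by omega) (S.inc x) (S.inc y) (S.inc z)
    have := map_V S.res (sub_V t1 t2)
    simpa only [S.res_inc] using this
  obtain ⟨ψ, hψV, hψa, hψi, hψ⟩ := h3 k φ Θ ha hi hΘa hχV (S.d3_V hd ha hχV) hob
  have hΘ2 : ∀ x y z, d2 (fun a b => S.Φ a b) (fun a b => (Θ - S.i2 ψ) a b) x y z
      ∈ V I E (k + 1) := by
    intro u v w
    have t1 := hob u v w
    have t2 := map_V S.inc (hψ (S.res u) (S.res v) (S.res w))
    rw [map_sub, ← S.d2_i hψi hψa] at t2
    have := sub_mem t2 t1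
    convert this using 1
    simp only [d2, LinearMap.sub_apply, map_sub]; abel
  have hiψV : ∀ x y, S.i2 ψ x y ∈ V I E k := fun x y => map_V S.inc (hψV _ _)
  obtain ⟨ψ', hψV', hψa', hψi', Λ, hΛV, hΛ⟩ := h2 k (Θ - S.i2 ψ)
    (fun x y => sub_mem (hΘV x y) (hiψV x y))
    (fun x => by rw [LinearMap.sub_apply, LinearMap.sub_apply, hΘa, S.i2_alt hψa, sub_zero]) hΘ2
  have hiψV' : ∀ x y, S.i2 ψ' x y ∈ V I E k := fun x y => map_V S.inc (hψV' _ _)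
  refine ⟨(φ + (ψ + ψ'), s ∘ₗ (LinearMap.id - Λ)), ⟨?_, ?_, ?_, ?_, ?_⟩, ?_, ?_⟩
  · intro x; simp [ha, hψa, hψa']
  · exact S.inv2_add hi (S.inv2_add hψi hψi')
  · intro x y
    have := add_mem (hd x y) (V_anti hk (add_mem (hψV x y) (hψV' x y)))
    convert this using 1
    simp only [LinearMap.add_apply]; abel
  · intro x
    have := sub_mem (hs x) (V_anti hk (map_V s (hΛV x)))
    convert this using 1
    simp only [LinearMap.comp_apply, LinearMap.sub_apply, LinearMap.id_apply, map_sub]; abel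
  · intro x y
    simp only [LinearMap.comp_apply, LinearMap.sub_apply, LinearMap.id_apply]
    rw [← hΨ1, ← map_sub]
    refine map_V s ?_
    have hΨ1d : ∀ x y, Ψ1 x y - S.Φ x y ∈ V I E 1 := by
      intro x y
      have := add_mem (V_anti hk (hΘV x y)) (hJV x y)
      convert this using 1
      simp only [hΘ, LinearMap.sub_apply]; abel
    have t1 := gauge S.alt hΨ1d Λ hk hΛV x y
    have t2 := hΛ x y
    -- Λ applied to small differences
    have t3 : Λ (Θ x y) ∈ V I E (k + 1) := V_anti (by omega) (map_V' Λ hΛV (hΘV x y))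
    have t4 : Λ (S.i2 (ψ + ψ') x y) ∈ V I E (k + 1) := by
      refine V_anti (by omega) (map_V' Λ hΛV (k := k) (map_V S.inc ?_))
      exact add_mem (hψV _ _) (hψV' _ _)
    have := add_mem (add_mem t1 t2) (sub_mem t4 t3)
    convert this using 1
    have e1 : Ψ1 x y = S.J φ x y + Θ x y := by simp [hΘ]
    have e2 : S.J (φ + (ψ + ψ')) x y = S.J φ x y + S.i2 (ψ + ψ') x y := by
      simp only [J, i2_apply, LinearMap.add_apply, LinearMap.sub_apply, map_add, map_sub]; abel
    have e3 : S.i2 (ψ + ψ') x y = S.i2 ψ x y + S.i2 ψ' x y := by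
      simp
    rw [e1, e2]
    simp only [map_add]
    have e4 : (Θ - S.i2 ψ) x y = Θ x y - S.i2 ψ x y := rfl
    rw [e3, e4]
    abel
  · intro x y
    simpa using add_mem (hψV x y) (hψV' x y)
  · intro x
    have := neg_mem (map_V s (hΛV x))
    simpa using this

/-- dependent sequences -/
lemma exists_seq {X : Type} (P : ℕ → X → Prop) (R : ℕ → X → X → Prop) (x0 : X) (h0 : P 1 x0)
    (hs : ∀ k, 1 ≤ k → ∀ x, P k x → ∃ y, P (k + 1) y ∧ R k x y) :
    ∃ f : ℕ → X, ∀ k, P (k + 1) (f k) ∧ R (k + 1) (f k) (f (k + 1)) := by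
  choose g hg1 hg2 using fun k : ℕ => hs (k + 1) (by omega)
  let F : (k : ℕ) → {x // P (k + 1) x} := fun k =>
    Nat.rec ⟨x0, h0⟩ (fun k x => ⟨g k x.1 x.2, hg1 k x.1 x.2⟩) k
  exact ⟨fun k => (F k).1, fun k => ⟨(F k).2, hg2 k (F k).1 (F k).2⟩⟩

theorem surj (hE : Comp I E) (hN : Comp I N) (h2 : S.L2s I) (h3 : S.L3i I) (Ψ : Bil A E)
    (hΨa : ∀ x, Ψ x x = 0) (hΨj : ∀ x y z, jc (fun a b => Ψ a b) x y z = 0)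
    (hΨd : ∀ x y, Ψ x y - S.Φ x y ∈ V I E 1) :
    ∃ φ : Bil A N, (∀ x, φ x x = 0) ∧ (∀ x y z, jc (fun a b => φ a b) x y z = 0) ∧ S.Inv2 φ ∧
      (∀ x y, φ x y - S.Φ' x y ∈ V I N 1) ∧
      ∃ s : E →ₗ[A] E, (∀ x, s x - x ∈ V I E 1) ∧ ∀ x y, Ψ (s x) (s y) = s (S.J φ x y) := by
  obtain ⟨f, hf⟩ := exists_seq (S.PS I Ψ) (fun k p q => (∀ x y, q.1 x y - p.1 x y ∈ V I N k) ∧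
      (∀ x, q.2 x - p.2 x ∈ V I E k)) (S.Φ', LinearMap.id)
    ⟨S.alt', S.invΦ', by simp, by simp, by simpa [J] using hΨd⟩
    (fun k hk p hp => S.stepS hE h2 h3 Ψ hΨa hΨj k hk p hp)
  obtain ⟨φ, hφ⟩ := bil_lim hN (fun k => (f k).1) (fun k x y => V_anti (by omega) ((hf k).2.1 x y))
  obtain ⟨s, hs⟩ := lin_lim hE (fun k => (f k).2) (fun k x => V_anti (by omega) ((hf k).2.2 x))
  have hφa : ∀ x, φ x x = 0 := by
    intro x
    refine hN.sep _ fun k => ?_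
    have := hφ k x x
    rwa [(hf k).1.1, sub_zero] at this
  have hφi : S.Inv2 φ := by
    intro u x y
    refine hN.eq fun k => ?_
    have t1 := map_V (S.ad u) (hφ k x y)
    have := sub_mem t1 (add_mem (hφ k (S.ad u x) y) (hφ k x (S.ad u y)))
    convert this using 1
    rw [map_sub, (hf k).1.2.1 u x y]
    abel
  have hφd : ∀ x y, φ x y - S.Φ' x y ∈ V I N 1 := by
    intro x y
    have := add_mem (hφ 1 x y) ((hf 1).1.2.2.1 x y)
    simpa using this
  have hsd : ∀ x, s x - x ∈ V I E 1 := by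
    intro x
    have := add_mem (hs 1 x) ((hf 1).1.2.2.2.1 x)
    simpa using this
  have hmain : ∀ x y, Ψ (s x) (s y) = s (S.J φ x y) := by
    intro x y
    refine hE.eq fun k => ?_
    have t0 := V_anti (Nat.le_succ k) ((hf k).1.2.2.2.2 x y)
    set φk := (f k).1
    set sk := (f k).2
    have t1 : Ψ (s x - sk x) (s y) ∈ V I E k := map_V (Ψ.flip (s y)) (hs k x)
    have t2 : Ψ (sk x) (s y - sk y) ∈ V I E k := map_V (Ψ (sk x)) (hs k y)
    have t3 := hs k (S.J φ x y)
    have t4 : sk (S.J φ x y - S.J φk x y) ∈ V I E k := by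
      apply map_V
      have := map_V S.inc (hφ k (S.res x) (S.res y))
      convert this using 1
      simp only [J, i2_apply, LinearMap.add_apply, LinearMap.sub_apply, map_sub]
      abel
    have := sub_mem (sub_mem (add_mem (add_mem t0 t1) t2) t3) t4
    convert this using 1
    simp only [map_sub, LinearMap.sub_apply]
    abel
  refine ⟨φ, hφa, ?_, hφi, hφd, s, hsd, hmain⟩
  intro x y z
  apply S.inc_inj
  have t := S.jc_J hφi hφa (S.inc x) (S.inc y) (S.inc z)
  simp only [S.res_inc] at t
  rw [← t, map_zero]
  apply (unip_bij hE s hsd).1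
  have := hΨj (s (S.inc x)) (s (S.inc y)) (s (S.inc z))
  simp only [jc] at this ⊢
  simp only [hmain] at this
  simpa using this

end Setup
end RT

namespace RT
namespace Setup
variable {A E N : Type} [CommRing A] [AddCommGroup E] [Module A E] [AddCommGroup N]
    [Module A N] (S : Setup A E N) {I : Ideal A}

/-- inductive state for injectivity -/
def PI (I : Ideal A) (φ' : Bil A N) (s : E →ₗ[A] E) (k : ℕ)
    (p : (N →ₗ[A] N) × (E →ₗ[A] E)) : Prop :=
  S.Inv1 p.1 ∧ (∀ x, p.1 x - x ∈ V I N 1) ∧ (∀ x, p.2 x - x ∈ V I E 1) ∧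
  (∀ u v, S.J φ' (p.2 u) (p.2 v) = p.2 (S.J φ' u v)) ∧ ∀ u, s u - p.2 (S.ig p.1 u) ∈ V I E k

lemma stepI (K : Type) [Field K] [CharZero K] [Algebra K A]
    (hE : Comp I E) (hN : Comp I N) (h1 : S.L1 I) (h2 : S.L2i I)
    (φ φ' : Bil A N) (ha : ∀ x, φ x x = 0) (ha' : ∀ x, φ' x x = 0)
    (hj : ∀ x y z, jc (fun a b => φ a b) x y z = 0)
    (hj' : ∀ x y z, jc (fun a b => φ' a b) x y z = 0)
    (hi : S.Inv2 φ) (hi' : S.Inv2 φ')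
    (hd : ∀ x y, φ x y - S.Φ' x y ∈ V I N 1) (hd' : ∀ x y, φ' x y - S.Φ' x y ∈ V I N 1)
    (s : E →ₗ[A] E) (hsJ : ∀ u v, S.J φ' (s u) (s v) = s (S.J φ u v))
    (k : ℕ) (hk : 1 ≤ k) (p : (N →ₗ[A] N) × (E →ₗ[A] E)) (hp : S.PI I φ' s k p) :
    ∃ q : (N →ₗ[A] N) × (E →ₗ[A] E), S.PI I φ' s (k + 1) q ∧
      (∀ x, q.1 x - p.1 x ∈ V I N k) := by
  obtain ⟨t, e⟩ := p
  obtain ⟨ht, htV, heV, heJ, hse⟩ := hp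
  simp only at *
  let τ : N ≃ₗ[A] N := LinearEquiv.ofBijective t (unip_bij hN t htV)
  let η : E ≃ₗ[A] E := LinearEquiv.ofBijective e (unip_bij hE e heV)
  let γ : E ≃ₗ[A] E := LinearEquiv.ofBijective (S.ig t) (unip_bij hE _ (S.ig_V htV))
  have hτ : ∀ x, τ x = t x := fun x => rfl
  have hη : ∀ x, η x = e x := fun x => rfl
  have hγ : ∀ x, γ x = S.ig t x := fun x => rfl
  let φ1 : Bil A N := (φ.compl₁₂ τ.symm.toLinearMap τ.symm.toLinearMap).compr₂ t
  have hφ1 : ∀ x y, φ1 (t x) (t y) = t (φ x y) := by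
    intro x y
    change t (φ (τ.symm (τ x)) (τ.symm (τ y))) = _
    simp
  have tsurj : ∀ x, ∃ y, t y = x := τ.surjective
  have gsurj : ∀ x, ∃ y, S.ig t y = x := γ.surjective
  have einj : Function.Injective e := η.injective
  have ha1 : ∀ x, φ1 x x = 0 := by
    intro x; obtain ⟨x, rfl⟩ := tsurj x; rw [hφ1, ha, map_zero]
  have hj1 : ∀ x y z, jc (fun a b => φ1 a b) x y z = 0 := by
    intro x y z
    obtain ⟨x, rfl⟩ := tsurj x; obtain ⟨y, rfl⟩ := tsurj y; obtain ⟨z, rfl⟩ := tsurj z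
    have := congrArg t (hj x y z)
    simp only [jc] at this ⊢
    simpa only [hφ1, map_add, map_zero] using this
  have hi1 : S.Inv2 φ1 := by
    intro u x y
    obtain ⟨x, rfl⟩ := tsurj x; obtain ⟨y, rfl⟩ := tsurj y
    rw [hφ1, ht, hi u, ht, ht, hφ1, hφ1, map_add]
  have hd1 : ∀ x y, φ1 x y - S.Φ' x y ∈ V I N 1 := by
    intro x y
    obtain ⟨x, rfl⟩ := tsurj x; obtain ⟨y, rfl⟩ := tsurj y
    rw [hφ1]
    have t1 := htV (φ x y)
    have t2 : S.Φ' (t x - x) (t y) ∈ V I N 1 := map_V (S.Φ'.flip (t y)) (htV x)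
    have t3 : S.Φ' x (t y - y) ∈ V I N 1 := map_V (S.Φ' x) (htV y)
    have := sub_mem (sub_mem (add_mem t1 (hd x y)) t2) t3
    convert this using 1
    simp only [map_sub, LinearMap.sub_apply]; abel
  have hJ1 : ∀ u v, S.J φ1 (S.ig t u) (S.ig t v) = S.ig t (S.J φ u v) := S.J_ig ht φ φ1 hφ1
  let s1 : E →ₗ[A] E := η.symm.toLinearMap ∘ₗ s ∘ₗ γ.symm.toLinearMap
  have hs1 : ∀ u, e (s1 (S.ig t u)) = s u := by
    intro u
    change η (η.symm (s (γ.symm (γ u)))) = _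
    simp
  have hs1V : ∀ v, s1 v - v ∈ V I E k := by
    intro v
    obtain ⟨u, rfl⟩ := gsurj v
    have := map_V η.symm.toLinearMap (hse u)
    rw [← hs1, ← map_sub, ← hη] at this
    simpa using this
  have hs1J : ∀ v w, S.J φ' (s1 v) (s1 w) = s1 (S.J φ1 v w) := by
    intro v w
    obtain ⟨u, rfl⟩ := gsurj v
    obtain ⟨u', rfl⟩ := gsurj w
    apply einj
    rw [← heJ, hs1, hs1, hsJ, hJ1, hs1]
  set Λ : E →ₗ[A] E := LinearMap.id - s1 with hΛ
  have hΛs : ∀ v, s1 v = v - Λ v := by intro v; simp [hΛ]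
  have hΛV : ∀ v, Λ v ∈ V I E k := by
    intro v; simpa [hΛ] using V_sub_symm (hs1V v)
  clear_value Λ s1
  set ψ : Bil A N := φ' - φ1 with hψ
  have hψs : ∀ x y, ψ x y = φ' x y - φ1 x y := by intro x y; simp [hψ]
  have hψe : φ1 + ψ = φ' := by simp [hψ]
  have hψa : ∀ x, ψ x x = 0 := by intro x; rw [hψs, ha', ha1, sub_zero]
  have hψi : S.Inv2 ψ := S.inv2_sub hi' hi1
  have hψ1 : ∀ x y, ψ x y ∈ V I N 1 := by
    intro x y
    have := sub_mem (hd' x y) (hd1 x y)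
    convert this using 1
    rw [hψs]; abel
  clear_value ψ
  have hJψ : ∀ u v, S.J φ' u v - S.J φ1 u v = S.i2 ψ u v := by
    intro u v
    simp only [J, i2_apply, hψs, LinearMap.add_apply, LinearMap.sub_apply, map_sub]
    abel
  have hJV := S.J_V hd'
  have hψΛ : ∀ u v, S.i2 ψ u v - d1 (fun a b => S.Φ a b) Λ u v ∈ V I E (k + 1) := by
    intro u v
    have t1 := gauge S.alt hJV Λ hk hΛV u v
    rw [← hΛs, ← hΛs, hs1J, hΛs] at t1
    have t2 : Λ (S.i2 ψ u v) ∈ V I E (k + 1) := map_V' Λ hΛV (map_V S.inc (hψ1 _ _))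
    have := sub_mem t2 t1
    convert this using 1
    rw [← hJψ, map_sub]
    abel
  have hd1V : ∀ u v, d1 (fun a b => S.Φ a b) Λ u v ∈ V I E k := by
    intro u v
    exact sub_mem (sub_mem (map_V (S.Φ u) (hΛV v)) (map_V (S.Φ v) (hΛV u))) (hΛV _)
  have hψV : ∀ x y, ψ x y ∈ V I N k := by
    intro x y
    have t1 := sub_V (V_anti (Nat.le_succ k) (hψΛ (S.inc x) (S.inc y))) (hd1V _ _)
    have t2 := map_V S.res t1
    simpa only [i2_apply, S.res_inc] using t2
  have hψd : ∀ x y z, d2 (fun a b => S.Φ' a b) (fun a b => ψ a b) x y z ∈ V I N (k + 1) := by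
    intro x y z
    have t1 := jc_expand ha1 hψa x y z
    rw [hψe, hj', hj1] at t1
    have t2 := jc_V hψV (show k + 1 ≤ k + k by omega) x y z
    have t3 := d2_V (Φ := φ1 - S.Φ') (Θ := ψ) (a := 1) (b := k) (k := k + 1)
      (by simpa using hd1) hψV (by omega) x y z
    have := sub_mem t2 t3
    convert this using 1
    have e2 : d2 (fun a b => (φ1 - S.Φ') a b) (fun a b => ψ a b) x y z =
      d2 (fun a b => φ1 a b) (fun a b => ψ a b) x y z -
      d2 (fun a b => S.Φ' a b) (fun a b => ψ a b) x y z := by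
      simp only [d2, LinearMap.sub_apply, map_sub]; abel
    rw [e2]
    have t4 : jc (fun a b => ψ a b) x y z = d2 (fun a b => φ1 a b) (fun a b => ψ a b) x y z := by
      rw [← sub_eq_zero]
      rw [t1]
      abel
    rw [t4]; abel
  obtain ⟨l, hli, hlV, hl⟩ := h2 k ψ hψV hψa hψi hψd ⟨Λ, hψΛ⟩
  obtain ⟨w, u, hwi, hwV, hu, hw⟩ := h1 k (S.i1 l - Λ)
    (fun x => sub_mem (map_V S.inc (hlV _)) (hΛV x)) (by
      intro x y
      have t1 := map_V S.inc (hl (S.res x) (S.res y))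
      rw [map_sub, ← S.d1_i hli] at t1
      have := sub_mem (hψΛ x y) t1
      convert this using 1
      simp only [d1, LinearMap.sub_apply, map_sub, i2_apply]
      abel)
  -- the inner automorphism
  have hJj' : ∀ x y z, jc (fun a b => S.J φ' a b) x y z = 0 := by
    intro x y z; rw [S.jc_J hi' ha', hj', map_zero]
  have hJa := S.J_alt ha'
  set B := S.J φ' with hB
  clear_value B
  obtain ⟨ε, hεJ, hεV⟩ := exp_aut (I := I) K hE B (B.flip u) (by
    intro x y
    have := hJj' x y u
    simp only [jc] at this
    simp only [LinearMap.flip_apply]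
    rw [anti hJa x (B y u), ← sub_eq_zero, ← this, anti hJa u x]
    simp only [map_neg, LinearMap.neg_apply]
    abel) hk (fun x => map_V (B x) hu)
  have hqV : ∀ x, (w - l) x ∈ V I N k := fun x => sub_mem (hwV x) (hlV x)
  have hεV1 : ∀ x, ε x - x ∈ V I E k := by
    intro x
    have := add_mem (V_anti (Nat.le_succ k) (hεV x)) (map_V (B x) hu)
    convert this using 1
    simp only [LinearMap.flip_apply]; abel
  refine ⟨(t + (w - l) ∘ₗ t, e ∘ₗ ε), ⟨?_, ?_, ?_, ?_, ?_⟩, ?_⟩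
  · intro u x
    simp only [LinearMap.add_apply, LinearMap.comp_apply, LinearMap.sub_apply, map_add, map_sub,
      ht u, hwi u, hli u]
  · intro x
    have := add_mem (htV x) (V_anti hk (hqV (t x)))
    convert this using 1
    simp only [LinearMap.add_apply, LinearMap.comp_apply]; abel
  · intro x
    have := add_mem (heV (ε x)) (V_anti hk (hεV1 x))
    simpa using this
  · intro x y
    simp only [LinearMap.comp_apply]
    rw [← hB, heJ, hεJ]
  · intro x
    simp only [LinearMap.comp_apply]
    set v := S.ig t x with hv
    have e1 : S.ig (t + (w - l) ∘ₗ t) x = v + S.inc ((w - l) (S.res v)) := by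
      rw [hv, S.res_ig, S.ig_apply, S.ig_apply]
      simp only [LinearMap.add_apply, LinearMap.comp_apply, map_add, map_sub]
      abel
    rw [e1, ← hs1, ← hv, ← map_sub]
    apply map_V
    set z := S.inc ((w - l) (S.res v)) with hz
    have hzV : z ∈ V I E k := map_V S.inc (hqV _)
    have t1 := hεV (v + z)
    have t2 : B z u ∈ V I E (k + 1) :=
      bil_V' B (a := 0) (fun _ _ => V_zero _) hzV hu (by omega)
    have t3 : (B - S.Φ) v u ∈ V I E (k + 1) :=
      bil_V' (B - S.Φ) (a := 1) (by simpa using hJV) (V_zero v) hu (by omega)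
    have t4 := hw v
    have := sub_mem (sub_mem (sub_mem t4 t1) t2) t3
    convert this using 1
    rw [hΛs]
    simp only [hz, LinearMap.flip_apply, map_add, LinearMap.add_apply, LinearMap.sub_apply,
      map_sub, i1_apply]
    abel
  · intro x
    simpa using hqV (t x)

theorem inj (K : Type) [Field K] [CharZero K] [Algebra K A]
    (hE : Comp I E) (hN : Comp I N) (h1 : S.L1 I) (h2 : S.L2i I)
    (φ φ' : Bil A N) (ha : ∀ x, φ x x = 0) (ha' : ∀ x, φ' x x = 0)
    (hj : ∀ x y z, jc (fun a b => φ a b) x y z = 0)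
    (hj' : ∀ x y z, jc (fun a b => φ' a b) x y z = 0)
    (hi : S.Inv2 φ) (hi' : S.Inv2 φ')
    (hd : ∀ x y, φ x y - S.Φ' x y ∈ V I N 1) (hd' : ∀ x y, φ' x y - S.Φ' x y ∈ V I N 1)
    (s : E →ₗ[A] E) (hs : ∀ x, s x - x ∈ V I E 1)
    (hsJ : ∀ u v, S.J φ' (s u) (s v) = s (S.J φ u v)) :
    ∃ t : N →ₗ[A] N, S.Inv1 t ∧ (∀ x, t x - x ∈ V I N 1) ∧
      ∀ x y, φ' (t x) (t y) = t (φ x y) := by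
  obtain ⟨f, hf⟩ := exists_seq (S.PI I φ' s) (fun k p q => (∀ x, q.1 x - p.1 x ∈ V I N k))
    (LinearMap.id, LinearMap.id)
    ⟨fun _ _ => rfl, by simp, by simp, fun _ _ => rfl, by simpa [ig_apply] using hs⟩
    (fun k hk p hp => S.stepI K hE hN h1 h2 φ φ' ha ha' hj hj' hi hi' hd hd' s hsJ k hk p hp)
  obtain ⟨t, ht⟩ := lin_lim hN (fun k => (f k).1) (fun k x => V_anti (by omega) ((hf k).2 x))
  refine ⟨t, ?_, ?_, ?_⟩
  · intro u x
    refine hN.eq fun k => ?_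
    have := sub_mem (map_V (S.ad u) (ht k x)) (ht k (S.ad u x))
    convert this using 1
    rw [map_sub, (hf k).1.1]; abel
  · intro x
    have := add_mem (ht 1 x) ((hf 1).1.2.1 x)
    simpa using this
  · intro x y
    refine hN.eq fun k => ?_
    obtain ⟨⟨hti, htV, heV, heJ, hse⟩, -⟩ := hf k
    set tk := (f k).1
    set e := (f k).2
    let η : E ≃ₗ[A] E := LinearEquiv.ofBijective e (unip_bij hE e heV)
    have t0 : ∀ u v, S.J φ' (S.ig tk u) (S.ig tk v) - S.ig tk (S.J φ u v) ∈ V I E k := by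
      intro u v
      have c1 : S.J φ' (s u - e (S.ig tk u)) (s v) ∈ V I E k :=
        map_V ((S.J φ').flip (s v)) (V_anti (Nat.le_succ k) (hse u))
      have c2 : S.J φ' (e (S.ig tk u)) (s v - e (S.ig tk v)) ∈ V I E k :=
        map_V (S.J φ' _) (V_anti (Nat.le_succ k) (hse v))
      have c3 := V_anti (Nat.le_succ k) (hse (S.J φ u v))
      have c4 : e (S.J φ' (S.ig tk u) (S.ig tk v) - S.ig tk (S.J φ u v)) ∈ V I E k := by
        have := sub_mem c3 (add_mem c1 c2)
        convert this using 1
        simp only [map_sub, LinearMap.sub_apply, ← heJ, ← hsJ]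
        abel
      have := map_V η.symm.toLinearMap c4
      have hη : ∀ z, η.symm (e z) = z := η.symm_apply_apply
      change η.symm (e _) ∈ _ at this
      rwa [hη] at this
    have t1 := map_V S.res (t0 (S.inc x) (S.inc y))
    have e1 : ∀ φ : Bil A N, ∀ u v, S.res (S.J φ u v) =
        φ (S.res u) (S.res v) + S.ad u (S.res v) - S.ad v (S.res u) := by
      intro φ u v
      simp only [J, LinearMap.add_apply, i2_apply, map_add, S.res_Φ, S.res_inc,
        LinearMap.sub_apply]
      abel
    have e2 : ∀ z, S.ad (S.ig tk (S.inc z)) = 0 := by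
      intro z
      simp only [S.ig_apply, map_add, S.ad_inc, add_zero]
    rw [map_sub, e1, S.res_ig, S.res_ig, S.res_ig, e1, e2, e2] at t1
    simp only [S.res_inc, S.ad_inc, LinearMap.zero_apply, add_zero, sub_zero] at t1
    have t2 : φ' (t x - tk x) (t y) ∈ V I N k := map_V (φ'.flip (t y)) (ht k x)
    have t3 : φ' (tk x) (t y - tk y) ∈ V I N k := map_V (φ' (tk x)) (ht k y)
    have := sub_mem (add_mem (add_mem t1 t2) t3) (ht k (φ x y))
    convert this using 1
    simp only [map_sub, LinearMap.sub_apply]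
    abel

end Setup
end RT

namespace RT
section coord
variable {A : Type} [CommRing A] {I : Ideal A}

lemma mem_V_pi {p k : ℕ} (x : Fin p → A) : x ∈ V I (Fin p → A) k ↔ ∀ i, x i ∈ I ^ k := by
  constructor
  · intro h i
    have := map_V (LinearMap.proj (R := A) (φ := fun _ : Fin p => A) i) h
    simpa [V] using this
  · intro h
    rw [pi_eq_sum_univ' x]
    exact sum_mem fun i _ => Submodule.smul_mem_smul (h i) trivial

lemma comp_pi [IsAdicComplete I A] (p : ℕ) : Comp I (Fin p → A) where
  sep x hx := by
    funext i
    refine IsHausdorff.haus (I := I) inferInstance _ fun k => ?_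
    rw [SModEq.zero]
    simpa using (mem_V_pi x).1 (hx k) i
  lim f hf := by
    have h := fun i => IsPrecomplete.prec (I := I) (M := A) inferInstance
      (f := fun k => f k i) (by
        intro a b hab
        rw [SModEq.comm, SModEq.sub_mem]
        simpa using (mem_V_pi _).1 (cauchy_le hf hab) i)
    choose L hL using h
    refine ⟨L, fun k => (mem_V_pi _).2 fun i => ?_⟩
    have := hL i k
    rw [SModEq.comm, SModEq.sub_mem] at this
    simpa using this

/-- bundling a raw bilinear map -/
def toBil {M : Type} [AddCommGroup M] [Module A M] {f : M → M → M} (h : IsBilin A f) : Bil A M :=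
  LinearMap.mk₂ A f (fun x x' y => by simpa using h.1 1 x x' y)
    (fun a x y => by
      have h0 : f 0 y = 0 := by simpa using h.1 1 0 0 y
      simpa [h0] using h.1 a x 0 y)
    (fun x y y' => by simpa using h.2 1 x y y')
    (fun a x y => by
      have h0 : f x 0 = 0 := by simpa using h.2 1 x 0 0
      simpa [h0] using h.2 a x y 0)

@[simp] lemma toBil_apply {M : Type} [AddCommGroup M] [Module A M] {f : M → M → M}
    (h : IsBilin A f) (x y : M) : toBil h x y = f x y := rfl

/-- bundling a raw linear map -/
def toL {M : Type} [AddCommGroup M] [Module A M] {f : M → M} (h : IsLin A f) : M →ₗ[A] M where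
  toFun := f
  map_add' x y := by simpa using h 1 x y
  map_smul' a x := by
      have h0 : f 0 = 0 := by simpa using h 1 0 0
      simpa [h0] using h a x 0

@[simp] lemma toL_apply {M : Type} [AddCommGroup M] [Module A M] {f : M → M}
    (h : IsLin A f) (x : M) : toL h x = f x := rfl

lemma isBilin {M : Type} [AddCommGroup M] [Module A M] (B : Bil A M) :
    IsBilin A (fun x y => B x y) := ⟨by intros; simp, by intros; simp⟩

/-- linear version of inclFun -/
def incL (A : Type) [CommRing A] (m n : ℕ) : (Fin n → A) →ₗ[A] (Fin m → A) where
  toFun := inclFun A m n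
  map_add' x y := by ext k; simp only [inclFun, Pi.add_apply]; split_ifs <;> simp
  map_smul' a x := by ext k; simp [inclFun]

/-- linear version of restFun -/
def resL (A : Type) [CommRing A] {m n : ℕ} (hnm : n ≤ m) : (Fin m → A) →ₗ[A] (Fin n → A) where
  toFun := restFun A n hnm
  map_add' x y := rfl
  map_smul' a x := rfl

@[simp] lemma incL_apply (m n : ℕ) (x : Fin n → A) : incL A m n x = inclFun A m n x := rfl
@[simp] lemma resL_apply {m n : ℕ} (hnm : n ≤ m) (x : Fin m → A) :
    resL A hnm x = restFun A n hnm x := rfl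

lemma resL_incL {m n : ℕ} (hnm : n ≤ m) (x : Fin n → A) : resL A hnm (incL A m n x) = x := by
  ext i; simp [restFun, inclFun]

variable {K : Type} [Field K] [Algebra K A]

/-- scalar extension of vectors -/
def io (A : Type) [CommRing A] [Algebra K A] {p : ℕ} (x : Fin p → K) : Fin p → A :=
  fun i => algebraMap K A (x i)

lemma io_add {p : ℕ} (x y : Fin p → K) : io A (x + y) = io A x + io A y := by
  ext i; simp [io]
lemma io_smul {p : ℕ} (a : K) (x : Fin p → K) : io A (a • x) = algebraMap K A a • io A x := by
  ext i; simp [io]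
lemma io_sub {p : ℕ} (x y : Fin p → K) : io A (x - y) = io A x - io A y := by
  ext i; simp [io]
lemma io_zero {p : ℕ} : io A (0 : Fin p → K) = 0 := by
  ext i; simp [io]
lemma io_neg {p : ℕ} (x : Fin p → K) : io A (-x) = - io A x := by
  ext i; simp [io]
lemma io_single {p : ℕ} (i : Fin p) : io A (Pi.single i (1 : K)) = Pi.single i 1 := by
  ext j; by_cases h : j = i
  · subst h; simp [io]
  · simp [io, h]
lemma io_inc {m n : ℕ} (x : Fin n → K) : io A (inclFun K m n x) = inclFun A m n (io A x) := by
  ext j; simp only [io, inclFun]; split_ifs <;> simp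
lemma io_res {m n : ℕ} (hnm : n ≤ m) (x : Fin m → K) :
    io A (restFun K n hnm x) = restFun A n hnm (io A x) := rfl
lemma io_sum {p r : ℕ} (x : Fin r → Fin p → K) : io A (∑ b, x b) = ∑ b, io A (x b) := by
  ext j; simp [io]

lemma lin_mem {M : Type} [AddCommGroup M] [Module A M] (W : Submodule A M) {p : ℕ}
    {f : (Fin p → A) → M} (hf : IsLinearMap A f) (h : ∀ x : Fin p → K, f (io A x) ∈ W)
    (u : Fin p → A) : f u ∈ W := by
  change hf.mk' f u ∈ W
  rw [pi_eq_sum_univ' u, map_sum]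
  refine sum_mem fun i _ => ?_
  rw [map_smul]
  refine W.smul_mem _ ?_
  have := h (Pi.single i 1)
  rw [io_single] at this
  exact this

lemma bil_mem {M : Type} [AddCommGroup M] [Module A M] (W : Submodule A M) {p q : ℕ}
    {f : (Fin p → A) → (Fin q → A) → M} (h1 : ∀ y, IsLinearMap A (fun x => f x y))
    (h2 : ∀ x, IsLinearMap A (fun y => f x y))
    (h : ∀ (x : Fin p → K) (y : Fin q → K), f (io A x) (io A y) ∈ W) (u : Fin p → A)
    (v : Fin q → A) : f u v ∈ W :=
  lin_mem (K := K) W (h1 v) (fun x => lin_mem (K := K) W (h2 _) (fun y => h x y) v) u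

lemma tri_mem {M : Type} [AddCommGroup M] [Module A M] (W : Submodule A M) {p : ℕ}
    {f : (Fin p → A) → (Fin p → A) → (Fin p → A) → M}
    (h1 : ∀ y z, IsLinearMap A (fun x => f x y z))
    (h2 : ∀ x z, IsLinearMap A (fun y => f x y z))
    (h3 : ∀ x y, IsLinearMap A (fun z => f x y z))
    (h : ∀ x y z : Fin p → K, f (io A x) (io A y) (io A z) ∈ W) (u v w : Fin p → A) :
    f u v w ∈ W :=
  bil_mem (K := K) W (fun v => h1 v w) (fun u => h2 u w)
    (fun x y => lin_mem (K := K) W (h3 _ _) (fun z => h x y z) w) u v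

/-- scalar extension of linear maps -/
def ext1 (A : Type) [CommRing A] [Algebra K A] {p q : ℕ} (f : (Fin p → K) → (Fin q → K)) :
    (Fin p → A) →ₗ[A] (Fin q → A) where
  toFun u k := ∑ j, algebraMap K A (f (Pi.single j 1) k) * u j
  map_add' x y := by ext k; simp [mul_add, Finset.sum_add_distrib]
  map_smul' a x := by
    ext k; simp only [Pi.smul_apply, smul_eq_mul, RingHom.id_apply, Finset.mul_sum]
    exact Finset.sum_congr rfl fun _ _ => by ring

/-- scalar extension of bilinear maps -/
def ext2 (A : Type) [CommRing A] [Algebra K A] {p : ℕ}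
    (f : (Fin p → K) → (Fin p → K) → (Fin p → K)) : Bil A (Fin p → A) :=
  LinearMap.mk₂ A (fun u v k => ∑ i, ∑ j, u i * v j *
      algebraMap K A (f (Pi.single i 1) (Pi.single j 1) k))
    (by intro x y z; ext k; simp [add_mul, Finset.sum_add_distrib])
    (by
      intro a y z; ext k
      simp only [Pi.smul_apply, smul_eq_mul, Finset.mul_sum]
      exact Finset.sum_congr rfl fun _ _ => Finset.sum_congr rfl fun _ _ => by ring)
    (by intro x y z; ext k; simp [add_mul, mul_add, Finset.sum_add_distrib])
    (by
      intro a y z; ext k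
      simp only [Pi.smul_apply, smul_eq_mul, Finset.mul_sum]
      exact Finset.sum_congr rfl fun _ _ => Finset.sum_congr rfl fun _ _ => by ring)

lemma lin_coord {p q : ℕ} (f : (Fin p → K) →ₗ[K] (Fin q → K)) (x : Fin p → K) :
    f x = ∑ j, x j • f (Pi.single j 1) := by
  conv_lhs => rw [pi_eq_sum_univ' x, map_sum]
  refine Finset.sum_congr rfl fun j _ => ?_
  rw [map_smul]

lemma ext1_io {p q : ℕ} (f : (Fin p → K) →ₗ[K] (Fin q → K)) (x : Fin p → K) :
    ext1 A f (io A x) = io A (f x) := by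
  ext k
  rw [lin_coord f x]
  simp [ext1, io, mul_comm]

lemma ext2_io {p : ℕ} (f : Bil K (Fin p → K)) (x y : Fin p → K) :
    ext2 A (fun a b => f a b) (io A x) (io A y) = io A (f x y) := by
  have h : f x y = ∑ i, ∑ j, (x i * y j) • f (Pi.single i 1) (Pi.single j 1) := by
    have := lin_coord (f.flip y) x
    rw [LinearMap.flip_apply] at this
    rw [this]
    refine Finset.sum_congr rfl fun i _ => ?_
    rw [LinearMap.flip_apply, lin_coord (f (Pi.single i 1)) y, Finset.smul_sum]
    exact Finset.sum_congr rfl fun j _ => smul_smul _ _ _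
  ext k
  rw [h]
  simp [ext2, io]

/-- coordinatewise functional -/
def ls {p : ℕ} (lam : A →ₗ[K] K) (w : Fin p → A) : Fin p → K := fun i => lam (w i)

lemma ls_add {p : ℕ} (lam : A →ₗ[K] K) (x y : Fin p → A) :
    ls lam (x + y) = ls lam x + ls lam y := by ext; simp [ls]
lemma ls_sub {p : ℕ} (lam : A →ₗ[K] K) (x y : Fin p → A) :
    ls lam (x - y) = ls lam x - ls lam y := by ext; simp [ls]
lemma ls_zero {p : ℕ} (lam : A →ₗ[K] K) : ls lam (0 : Fin p → A) = 0 := by ext; simp [ls]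
lemma ls_smul {p : ℕ} (lam : A →ₗ[K] K) (a : K) (x : Fin p → A) :
    ls lam (algebraMap K A a • x) = a • ls lam x := by
  ext i
  simp only [ls, Pi.smul_apply, smul_eq_mul]
  rw [← Algebra.smul_def, map_smul, smul_eq_mul]
lemma ls_sum {p r : ℕ} (lam : A →ₗ[K] K) (x : Fin r → Fin p → A) :
    ls lam (∑ b, x b) = ∑ b, ls lam (x b) := by ext; simp [ls]

lemma ls_lin {p q : ℕ} (lam : A →ₗ[K] K) (F : (Fin p → A) →ₗ[A] (Fin q → A))
    (f : (Fin p → K) →ₗ[K] (Fin q → K)) (h : ∀ x, F (io A x) = io A (f x)) (w : Fin p → A) :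
    ls lam (F w) = f (ls lam w) := by
  rw [lin_coord f]
  conv_lhs => rw [pi_eq_sum_univ' w, map_sum, ls_sum]
  refine Finset.sum_congr rfl fun j _ => ?_
  rw [map_smul, ← io_single (K := K), h]
  ext i
  simp only [ls, Pi.smul_apply, smul_eq_mul, io]
  rw [mul_comm, ← Algebra.smul_def, map_smul, smul_eq_mul, mul_comm]

/-- combination of scalar extended vectors -/
def cmb {p r : ℕ} (v : Fin r → A) (z : Fin r → Fin p → K) : Fin p → A := ∑ b, v b • io A (z b)

lemma cmb_add {p r : ℕ} (v : Fin r → A) (z z' : Fin r → Fin p → K) :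
    cmb v z + cmb v z' = cmb v (fun b => z b + z' b) := by
  simp [cmb, io_add, Finset.sum_add_distrib]
lemma cmb_sub {p r : ℕ} (v : Fin r → A) (z z' : Fin r → Fin p → K) :
    cmb v z - cmb v z' = cmb v (fun b => z b - z' b) := by
  simp [cmb, io_sub, smul_sub]
lemma cmb_lin {p q r : ℕ} (v : Fin r → A) (F : (Fin p → A) →ₗ[A] (Fin q → A))
    (f : (Fin p → K) →ₗ[K] (Fin q → K)) (h : ∀ x, F (io A x) = io A (f x))
    (z : Fin r → Fin p → K) : F (cmb v z) = cmb v (fun b => f (z b)) := by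
  simp [cmb, h]
lemma cmb_mem {p r k : ℕ} {v : Fin r → A} (hv : ∀ b, v b ∈ I ^ k) (z : Fin r → Fin p → K) :
    cmb v z ∈ V I (Fin p → A) k :=
  sum_mem fun b _ => Submodule.smul_mem_smul (hv b) trivial

/-- combination of linear maps -/
def re1 {p q r : ℕ} (v : Fin r → A) (g : Fin r → (Fin p → K) → (Fin q → K)) :
    (Fin p → A) →ₗ[A] (Fin q → A) := ∑ b, v b • ext1 A (g b)
/-- combination of bilinear maps -/
def re2 {p r : ℕ} (v : Fin r → A) (g : Fin r → (Fin p → K) → (Fin p → K) → (Fin p → K)) :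
    Bil A (Fin p → A) := ∑ b, v b • ext2 A (g b)

lemma re1_io {p r : ℕ} (v : Fin r → A) {g : Fin r → (Fin p → K) → (Fin p → K)}
    (hg : ∀ b, IsLin K (g b)) (x : Fin p → K) :
    re1 v g (io A x) = cmb v (fun b => g b x) := by
  simp only [re1, cmb, LinearMap.sum_apply, LinearMap.smul_apply]
  exact Finset.sum_congr rfl fun b _ => by rw [← toL_apply (hg b), ← ext1_io (toL (hg b))]; rfl
lemma re2_io {p r : ℕ} (v : Fin r → A) {g : Fin r → (Fin p → K) → (Fin p → K) → (Fin p → K)}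
    (hg : ∀ b, IsBilin K (g b)) (x y : Fin p → K) :
    re2 v g (io A x) (io A y) = cmb v (fun b => g b x y) := by
  simp only [re2, cmb, LinearMap.sum_apply, LinearMap.smul_apply]
  exact Finset.sum_congr rfl fun b _ => by
    rw [← toBil_apply (hg b), ← ext2_io (toBil (hg b))]; rfl
lemma re1_mem {p q r k : ℕ} {v : Fin r → A} (hv : ∀ b, v b ∈ I ^ k)
    (g : Fin r → (Fin p → K) → (Fin q → K)) (x : Fin p → A) :
    re1 v g x ∈ V I (Fin q → A) k := by
  simp only [re1, LinearMap.sum_apply, LinearMap.smul_apply]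
  exact sum_mem fun b _ => Submodule.smul_mem_smul (hv b) trivial
lemma re2_mem {p r k : ℕ} {v : Fin r → A} (hv : ∀ b, v b ∈ I ^ k)
    (g : Fin r → (Fin p → K) → (Fin p → K) → (Fin p → K)) (x y : Fin p → A) :
    re2 v g x y ∈ V I (Fin p → A) k := by
  simp only [re2, LinearMap.sum_apply, LinearMap.smul_apply]
  exact sum_mem fun b _ => Submodule.smul_mem_smul (hv b) trivial

lemma alt_ext [CharZero K] {p : ℕ} {B : Bil A (Fin p → A)}
    (h : ∀ x y : Fin p → K, B (io A x) (io A y) = - B (io A y) (io A x)) (u : Fin p → A) :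
    B u u = 0 := by
  have h1 := bil_mem (K := K) (⊥ : Submodule A (Fin p → A)) (f := fun u v => B u v + B v u)
    (fun y => ⟨by intros; simp only [map_add, LinearMap.add_apply]; abel,
      by intros; simp⟩)
    (fun y => ⟨by intros; simp only [map_add, LinearMap.add_apply]; abel,
      by intros; simp⟩)
    (fun x y => by rw [h x y]; simp) u u
  simp only [Submodule.mem_bot] at h1
  apply nsmul_cancel (A := A) K 1
  rw [smul_zero]
  change 2 • B u u = 0
  rw [two_nsmul]; exact h1

/-- The graded pieces have finite dual bases. -/
structure Split (K : Type) [Field K] [Algebra K A] (I : Ideal A) (k : ℕ) where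
  r : ℕ
  v : Fin r → A
  lam : Fin r → A →ₗ[K] K
  hv : ∀ b, v b ∈ I ^ k
  hlam : ∀ b, ∀ a ∈ I ^ (k + 1), lam b a = 0
  hdec : ∀ a ∈ I ^ k, a - ∑ b, v b * algebraMap K A (lam b a) ∈ I ^ (k + 1)

lemma Split.ls_zero {k : ℕ} (σ : Split K I k) {p : ℕ} {w : Fin p → A}
    (hw : w ∈ V I (Fin p → A) (k + 1)) (b : Fin σ.r) : ls (σ.lam b) w = 0 := by
  ext i
  exact σ.hlam b _ ((mem_V_pi w).1 hw i)

lemma Split.dec {k : ℕ} (σ : Split K I k) {p : ℕ} {w : Fin p → A}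
    (hw : w ∈ V I (Fin p → A) k) :
    w - cmb σ.v (fun b => ls (σ.lam b) w) ∈ V I (Fin p → A) (k + 1) := by
  rw [mem_V_pi]
  intro i
  have := σ.hdec _ ((mem_V_pi w).1 hw i)
  simpa [cmb, ls, io] using this

lemma exists_split [IsNoetherianRing A] (pr : A →ₐ[K] K) (hpr : ∀ a, a ∈ I ↔ pr a = 0) (k : ℕ) :
    Nonempty (Split K I k) := by
  let W1 : Submodule K A := (I ^ (k + 1)).restrictScalars K
  let W : Submodule K A := (I ^ k).restrictScalars K
  let W' : Submodule K (A ⧸ W1) := W.map W1.mkQ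
  obtain ⟨G, hG⟩ := (IsNoetherian.noetherian (I ^ k) : (I ^ k).FG)
  have hle : W' ≤ Submodule.span K (W1.mkQ '' (G : Set A)) := by
    rintro _ ⟨a, ha, rfl⟩
    have ha' : a ∈ I ^ k := ha
    rw [← hG] at ha'
    induction ha' using Submodule.span_induction with
    | mem x hx => exact Submodule.subset_span ⟨x, hx, rfl⟩
    | zero => simp
    | add x y hx hy h1 h2 =>
      rw [map_add]
      rw [hG] at hx hy
      exact add_mem (h1 hx) (h2 hy)
    | smul c x hx h1 =>
      rw [hG] at hx
      have e : W1.mkQ (c • x) = pr c • W1.mkQ x := by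
        rw [← map_smul, ← sub_eq_zero, ← map_sub]
        rw [Submodule.mkQ_apply, Submodule.Quotient.mk_eq_zero]
        change c • x - pr c • x ∈ I ^ (k + 1)
        rw [smul_eq_mul, Algebra.smul_def (pr c), ← sub_mul, pow_succ']
        refine Ideal.mul_mem_mul ?_ hx
        rw [hpr]; simp
      rw [e]
      exact Submodule.smul_mem _ _ (h1 hx)
  have hfd : FiniteDimensional K W' := by
    have : FiniteDimensional K (Submodule.span K (W1.mkQ '' (G : Set A))) :=
      FiniteDimensional.span_of_finite K ((Finset.finite_toSet G).image _)
    exact Submodule.finiteDimensional_of_le hle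
  let bs := Module.finBasis K W'
  have hb : ∀ b, ∃ a ∈ I ^ k, W1.mkQ a = (bs b : A ⧸ W1) := fun b => by
    obtain ⟨a, ha, h⟩ := (bs b).2
    exact ⟨a, ha, h⟩
  choose v hv hvb using hb
  have hc : ∀ b, ∃ g : (A ⧸ W1) →ₗ[K] K, g ∘ₗ W'.subtype = bs.coord b := fun b =>
    LinearMap.exists_extend _
  choose g hg using hc
  refine ⟨⟨_, v, fun b => g b ∘ₗ W1.mkQ, hv, ?_, ?_⟩⟩
  · intro b a ha
    have : W1.mkQ a = 0 := by
      rw [Submodule.mkQ_apply, Submodule.Quotient.mk_eq_zero]; exact ha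
    rw [LinearMap.comp_apply, this, map_zero]
  · intro a ha
    have : W1.mkQ (a - ∑ b, v b * algebraMap K A ((g b ∘ₗ W1.mkQ) a)) = 0 := by
      have e1 : W1.mkQ a = ((⟨W1.mkQ a, ⟨a, ha, rfl⟩⟩ : W') : A ⧸ W1) := rfl
      have e2 := bs.sum_repr ⟨W1.mkQ a, ⟨a, ha, rfl⟩⟩
      have e3 := congrArg W'.subtype e2
      rw [map_sum] at e3
      rw [map_sub, map_sum, sub_eq_zero]
      refine Eq.trans e1 (Eq.trans e3.symm ?_)
      refine Finset.sum_congr rfl fun b _ => ?_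
      rw [mul_comm, ← Algebra.smul_def, map_smul, map_smul, hvb]
      congr 1
      have := LinearMap.congr_fun (hg b) ⟨W1.mkQ a, ⟨a, ha, rfl⟩⟩
      simpa using this.symm
    rw [Submodule.mkQ_apply, Submodule.Quotient.mk_eq_zero] at this
    exact this

end coord
end RT

namespace RT
section lift
variable {A : Type} [CommRing A] {I : Ideal A} {K : Type} [Field K] [Algebra K A]

/-- component of a linear map -/
def dn1 {p q : ℕ} (lam : A →ₗ[K] K) (F : (Fin p → A) →ₗ[A] (Fin q → A)) :
    (Fin p → K) →ₗ[K] (Fin q → K) where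
  toFun x := ls lam (F (io A x))
  map_add' x y := by rw [io_add, map_add, ls_add]
  map_smul' a x := by rw [io_smul, map_smul, ls_smul]; rfl

/-- component of a bilinear map -/
def dn2 {p : ℕ} (lam : A →ₗ[K] K) (F : Bil A (Fin p → A)) : Bil K (Fin p → K) :=
  LinearMap.mk₂ K (fun x y => ls lam (F (io A x) (io A y)))
    (by intro x y z; rw [io_add, map_add, LinearMap.add_apply, ls_add])
    (by intro a x y; rw [io_smul, map_smul, LinearMap.smul_apply, ls_smul])
    (by intro x y z; rw [io_add, map_add, ls_add])
    (by intro a x y; rw [io_smul, map_smul, ls_smul])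

lemma dn1_apply {p q : ℕ} (lam : A →ₗ[K] K) (F : (Fin p → A) →ₗ[A] (Fin q → A)) (x : Fin p → K) :
    dn1 lam F x = ls lam (F (io A x)) := rfl
lemma dn2_apply {p : ℕ} (lam : A →ₗ[K] K) (F : Bil A (Fin p → A)) (x y : Fin p → K) :
    dn2 lam F x y = ls lam (F (io A x) (io A y)) := rfl

lemma re1_io' {p r : ℕ} (v : Fin r → A) (g : Fin r → (Fin p → K) →ₗ[K] (Fin p → K))
    (x : Fin p → K) : re1 v (fun b => g b) (io A x) = cmb v (fun b => g b x) :=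
  re1_io v (fun b => by intro a x y; simp) x
lemma re2_io' {p r : ℕ} (v : Fin r → A) (g : Fin r → Bil K (Fin p → K)) (x y : Fin p → K) :
    re2 v (fun b x y => g b x y) (io A x) (io A y) = cmb v (fun b => g b x y) :=
  re2_io v (fun b => isBilin (g b)) x y

section gen
variable {p : ℕ} {B : Bil A (Fin p → A)} {β : Bil K (Fin p → K)}
  (h : ∀ x y, B (io A x) (io A y) = io A (β x y))
include h

lemma ls_d1 (lam : A →ₗ[K] K) (F : (Fin p → A) →ₗ[A] (Fin p → A)) (x y : Fin p → K) :
    ls lam (d1 (fun a b => B a b) F (io A x) (io A y))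
      = d1 (fun a b => β a b) (dn1 lam F) x y := by
  simp only [d1, ls_sub, ls_lin lam (B (io A _)) (β _) (h _), h, dn1_apply]

lemma ls_d2 (lam : A →ₗ[K] K) (F : Bil A (Fin p → A)) (x y z : Fin p → K) :
    ls lam (d2 (fun a b => B a b) (fun a b => F a b) (io A x) (io A y) (io A z))
      = d2 (fun a b => β a b) (fun a b => dn2 lam F a b) x y z := by
  simp only [d2, ls_sub, ls_add, ls_lin lam (B (io A _)) (β _) (h _), h, dn2_apply]

lemma ls_d3 (lam : A →ₗ[K] K) (χ : (Fin p → A) → (Fin p → A) → (Fin p → A) → (Fin p → A))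
    (x y z w : Fin p → K) :
    ls lam (d3 (fun a b => B a b) χ (io A x) (io A y) (io A z) (io A w))
      = d3 (fun a b => β a b) (fun a b c => ls lam (χ (io A a) (io A b) (io A c))) x y z w := by
  simp only [d3, ls_sub, ls_add, ls_lin lam (B (io A _)) (β _) (h _), h]

lemma re_d1 {r : ℕ} (v : Fin r → A) (g : Fin r → (Fin p → K) →ₗ[K] (Fin p → K))
    (x y : Fin p → K) :
    d1 (fun a b => B a b) (re1 v (fun b => g b)) (io A x) (io A y)
      = cmb v (fun b => d1 (fun a b => β a b) (g b) x y) := by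
  simp only [d1, h, re1_io', cmb_lin v (B (io A _)) (β _) (h _), cmb_sub]

lemma re_d2 {r : ℕ} (v : Fin r → A) (g : Fin r → Bil K (Fin p → K))
    (x y z : Fin p → K) :
    d2 (fun a b => B a b) (fun a c => re2 v (fun b x y => g b x y) a c) (io A x) (io A y) (io A z)
      = cmb v (fun b => d2 (fun a b => β a b) (fun a c => g b a c) x y z) := by
  simp only [d2, h, re2_io', cmb_lin v (B (io A _)) (β _) (h _), cmb_sub, cmb_add]
end gen

lemma cmb_neg {p r : ℕ} (v : Fin r → A) (z : Fin r → Fin p → K) :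
    - cmb v z = cmb v (fun b => - z b) := by
  simp [cmb, io_neg]

lemma re2_alt [CharZero K] {p r : ℕ} (v : Fin r → A) {g : Fin r → Bil K (Fin p → K)}
    (hg : ∀ b x, g b x x = 0) (u : Fin p → A) : re2 v (fun b x y => g b x y) u u = 0 := by
  refine alt_ext (K := K) (fun x y => ?_) u
  rw [re2_io', re2_io', cmb_neg]
  congr 1; ext1 b; exact anti (hg b) x y

variable {m n : ℕ}

/-- `S` is the scalar extension of `T` -/
structure Cpt (T : Setup K (Fin m → K) (Fin n → K)) (S : Setup A (Fin m → A) (Fin n → A)) :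
    Prop where
  Φ : ∀ x y, S.Φ (io A x) (io A y) = io A (T.Φ x y)
  Φ' : ∀ x y, S.Φ' (io A x) (io A y) = io A (T.Φ' x y)
  ad : ∀ x y, S.ad (io A x) (io A y) = io A (T.ad x y)
  inc : ∀ x, S.inc (io A x) = io A (T.inc x)
  res : ∀ x, S.res (io A x) = io A (T.res x)

variable {T : Setup K (Fin m → K) (Fin n → K)} {S : Setup A (Fin m → A) (Fin n → A)}
  (hc : Cpt T S)
include hc

lemma Cpt.inv1 {r : ℕ} (v : Fin r → A) {g : Fin r → (Fin n → K) →ₗ[K] (Fin n → K)}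
    (hg : ∀ b, T.Inv1 (g b)) : S.Inv1 (re1 v (fun b => g b)) := by
  intro u x
  rw [← sub_eq_zero, ← Submodule.mem_bot A]
  refine bil_mem (K := K) ⊥ (f := fun u x => S.ad u (re1 v (fun b => g b) x)
    - re1 v (fun b => g b) (S.ad u x)) (fun y => ⟨?_, ?_⟩) (fun y => ⟨?_, ?_⟩) (fun y z => ?_) u x
  · intros; simp only [map_add, LinearMap.add_apply]; abel
  · intros; simp only [map_smul, LinearMap.smul_apply, smul_sub]
  · intros; simp only [map_add]; abel
  · intros; simp only [map_smul, smul_sub]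
  · simp only [hc.ad, re1_io', cmb_lin v (S.ad (io A _)) (T.ad _) (hc.ad _)]
    simp only [hg _ y z, sub_self, Submodule.zero_mem]

lemma Cpt.inv2 {r : ℕ} (v : Fin r → A) {g : Fin r → Bil K (Fin n → K)}
    (hg : ∀ b, T.Inv2 (g b)) : S.Inv2 (re2 v (fun b x y => g b x y)) := by
  intro u x y
  rw [← sub_eq_zero, ← Submodule.mem_bot A]
  set G := re2 v (fun b x y => g b x y) with hG
  refine lin_mem (K := K) ⊥ (f := fun u => S.ad u (G x y) - (G (S.ad u x) y + G x (S.ad u y)))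
    ⟨?_, ?_⟩ (fun u => ?_) u
  · intros; simp only [map_add, LinearMap.add_apply]; abel
  · intros; simp only [map_smul, LinearMap.smul_apply, smul_sub, smul_add]
  refine bil_mem (K := K) ⊥ (f := fun x y => S.ad (io A u) (G x y)
    - (G (S.ad (io A u) x) y + G x (S.ad (io A u) y)))
    (fun y => ⟨?_, ?_⟩) (fun y => ⟨?_, ?_⟩) (fun y z => ?_) x y
  · intros; simp only [map_add, LinearMap.add_apply]; abel
  · intros; simp only [map_smul, LinearMap.smul_apply, smul_sub, smul_add]
  · intros; simp only [map_add]; abel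
  · intros; simp only [map_smul, smul_sub, smul_add]
  · simp only [hG, hc.ad, re2_io', cmb_lin v (S.ad (io A _)) (T.ad _) (hc.ad _), cmb_add]
    simp only [hg _ u y z, sub_self, Submodule.zero_mem]

lemma Cpt.dn_inv2 (lam : A →ₗ[K] K) {ψ : Bil A (Fin n → A)} (hψ : S.Inv2 ψ) :
    T.Inv2 (dn2 lam ψ) := by
  intro u x y
  simp only [dn2_apply]
  rw [← ls_lin lam (S.ad (io A u)) (T.ad u) (hc.ad u), hψ, ls_add, hc.ad, hc.ad]

lemma Cpt.L1 (hσ : ∀ k, Nonempty (Split K I k))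
    (H : ∀ c : (Fin m → K) →ₗ[K] (Fin m → K), (∀ x y, d1 (fun a b => T.Φ a b) c x y = 0) →
      ∃ (w : (Fin n → K) →ₗ[K] (Fin n → K)) (u : Fin m → K), T.Inv1 w ∧
        ∀ x, c x = T.i1 w x + T.Φ x u) : S.L1 I := by
  intro k c hc1 hc2
  obtain ⟨σ⟩ := hσ k
  have := fun b => H (dn1 (σ.lam b) c) (fun x y => by
    rw [← ls_d1 hc.Φ, σ.ls_zero (hc2 _ _)])
  choose w u hw hwu using this
  refine ⟨re1 σ.v (fun b => w b), cmb σ.v u, hc.inv1 _ hw, re1_mem σ.hv _, cmb_mem σ.hv _,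
    fun x => ?_⟩
  refine lin_mem (K := K) _ (f := fun x => c x - (S.i1 (re1 σ.v (fun b => w b)) x
    + S.Φ x (cmb σ.v u))) ⟨?_, ?_⟩ (fun x => ?_) x
  · intros; simp only [map_add, LinearMap.add_apply]; abel
  · intros; simp only [map_smul, LinearMap.smul_apply, smul_sub, smul_add]
  · have := σ.dec (hc1 (io A x))
    simp only [← dn1_apply, hwu] at this
    simpa only [Setup.i1_apply, hc.res, re1_io', cmb_lin σ.v S.inc T.inc hc.inc,
      cmb_lin σ.v (S.Φ (io A _)) (T.Φ _) (hc.Φ _), cmb_add] using this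

lemma Cpt.L2i (hσ : ∀ k, Nonempty (Split K I k))
    (H : ∀ ψ : Bil K (Fin n → K), (∀ x, ψ x x = 0) → T.Inv2 ψ →
      (∀ x y z, d2 (fun a b => T.Φ' a b) (fun a b => ψ a b) x y z = 0) →
      (∃ Λ : (Fin m → K) →ₗ[K] (Fin m → K), ∀ u v, T.i2 ψ u v = d1 (fun a b => T.Φ a b) Λ u v) →
      ∃ l : (Fin n → K) →ₗ[K] (Fin n → K), T.Inv1 l ∧
        ∀ x y, ψ x y = d1 (fun a b => T.Φ' a b) l x y) : S.L2i I := by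
  rintro k ψ h1 ha hi h2 ⟨Λ, hΛ⟩
  obtain ⟨σ⟩ := hσ k
  have := fun b => H (dn2 (σ.lam b) ψ) (fun x => by rw [dn2_apply, ha, ls_zero])
    (hc.dn_inv2 _ hi) (fun x y z => by rw [← ls_d2 hc.Φ', σ.ls_zero (h2 _ _ _)])
    ⟨dn1 (σ.lam b) Λ, fun u v => by
      rw [← sub_eq_zero, ← ls_d1 hc.Φ, Setup.i2_apply, dn2_apply,
        ← ls_lin _ S.inc T.inc hc.inc, ← ls_sub]
      have := σ.ls_zero (hΛ (io A u) (io A v)) b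
      rwa [Setup.i2_apply, hc.res, hc.res] at this⟩
  choose l hl hlψ using this
  refine ⟨re1 σ.v (fun b => l b), hc.inv1 _ hl, re1_mem σ.hv _, fun x y => ?_⟩
  refine bil_mem (K := K) _ (f := fun x y => ψ x y
    - d1 (fun a b => S.Φ' a b) (re1 σ.v (fun b => l b)) x y)
    (fun y => ⟨?_, ?_⟩) (fun y => ⟨?_, ?_⟩) (fun x y => ?_) x y
  · intros; simp only [d1, map_add, LinearMap.add_apply]; abel
  · intros; simp only [d1, map_smul, LinearMap.smul_apply, smul_sub]
  · intros; simp only [d1, map_add, LinearMap.add_apply]; abel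
  · intros; simp only [d1, map_smul, LinearMap.smul_apply, smul_sub]
  · have := σ.dec (h1 (io A x) (io A y))
    simp only [← dn2_apply, hlψ] at this
    rwa [re_d1 hc.Φ']

lemma Cpt.L2s [CharZero K] (hσ : ∀ k, Nonempty (Split K I k))
    (H : ∀ Ψ : Bil K (Fin m → K), (∀ x, Ψ x x = 0) →
      (∀ x y z, d2 (fun a b => T.Φ a b) (fun a b => Ψ a b) x y z = 0) →
      ∃ ψ : Bil K (Fin n → K), (∀ x, ψ x x = 0) ∧ T.Inv2 ψ ∧
      ∃ Λ : (Fin m → K) →ₗ[K] (Fin m → K), ∀ u v, Ψ u v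
        = T.i2 ψ u v + d1 (fun a b => T.Φ a b) Λ u v) : S.L2s I := by
  intro k Ψ h1 ha h2
  obtain ⟨σ⟩ := hσ k
  have := fun b => H (dn2 (σ.lam b) Ψ) (fun x => by rw [dn2_apply, ha, ls_zero])
    (fun x y z => by rw [← ls_d2 hc.Φ, σ.ls_zero (h2 _ _ _)])
  choose ψ hψa hψi Λ hΛ using this
  refine ⟨re2 σ.v (fun b x y => ψ b x y), re2_mem σ.hv _, re2_alt _ hψa, hc.inv2 _ hψi,
    re1 σ.v (fun b => Λ b), re1_mem σ.hv _, fun x y => ?_⟩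
  refine bil_mem (K := K) _ (f := fun x y => Ψ x y - (S.i2 (re2 σ.v (fun b x y => ψ b x y)) x y
    + d1 (fun a b => S.Φ a b) (re1 σ.v (fun b => Λ b)) x y))
    (fun y => ⟨?_, ?_⟩) (fun y => ⟨?_, ?_⟩) (fun x y => ?_) x y
  · intros; simp only [d1, map_add, LinearMap.add_apply]; abel
  · intros; simp only [d1, map_smul, LinearMap.smul_apply, smul_sub, smul_add]
  · intros; simp only [d1, map_add, LinearMap.add_apply]; abel
  · intros; simp only [d1, map_smul, LinearMap.smul_apply, smul_sub, smul_add]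
  · have := σ.dec (h1 (io A x) (io A y))
    simp only [← dn2_apply, hΛ] at this
    rw [re_d1 hc.Φ]
    simpa only [Setup.i2_apply, hc.res, re2_io', cmb_lin σ.v S.inc T.inc hc.inc, cmb_add] using this

lemma Cpt.L3i [CharZero K] (hσ : ∀ k, Nonempty (Split K I k))
    (H : ∀ χ : (Fin n → K) → (Fin n → K) → (Fin n → K) → (Fin n → K),
      IsTrilin K χ → (∀ x y z, (x = y ∨ y = z ∨ x = z) → χ x y z = 0) →
      (∀ u x y z, T.ad u (χ x y z)
        = χ (T.ad u x) y z + χ x (T.ad u y) z + χ x y (T.ad u z)) →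
      (∀ x y z w, d3 (fun a b => T.Φ' a b) χ x y z w = 0) →
      (∃ Ψ : Bil K (Fin m → K), (∀ x, Ψ x x = 0) ∧ ∀ u v w,
        T.inc (χ (T.res u) (T.res v) (T.res w))
          = d2 (fun a b => T.Φ a b) (fun a b => Ψ a b) u v w) →
      ∃ ψ : Bil K (Fin n → K), (∀ x, ψ x x = 0) ∧ T.Inv2 ψ ∧
        ∀ x y z, χ x y z = d2 (fun a b => T.Φ' a b) (fun a b => ψ a b) x y z) : S.L3i I := by
  intro k φ Θ ha hi hΘ h1 h2 h3
  obtain ⟨σ⟩ := hσ k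
  set χ := jc (fun a b => φ a b) with hχ
  have := fun b => H (fun x y z => ls (σ.lam b) (χ (io A x) (io A y) (io A z)))
    ⟨by
      intro a x x' y z
      beta_reduce
      rw [io_add, io_smul, ← ls_smul, ← ls_add]
      congr 1
      simp only [hχ, jc, map_add, map_smul, LinearMap.add_apply, LinearMap.smul_apply, smul_add]
      abel, by
      intro a x x' y z
      beta_reduce
      rw [io_add, io_smul, ← ls_smul, ← ls_add]
      congr 1
      simp only [hχ, jc, map_add, map_smul, LinearMap.add_apply, LinearMap.smul_apply, smul_add]
      abel, by
      intro a x x' y z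
      beta_reduce
      rw [io_add, io_smul, ← ls_smul, ← ls_add]
      congr 1
      simp only [hχ, jc, map_add, map_smul, LinearMap.add_apply, LinearMap.smul_apply, smul_add]
      abel⟩
    (fun x y z hxyz => by
      have : χ (io A x) (io A y) (io A z) = 0 := jc_self ha _ _ _ (by
        rcases hxyz with rfl | rfl | rfl <;> simp)
      rw [this, ls_zero])
    (fun u x y z => by
      rw [← ls_lin (σ.lam b) (S.ad (io A u)) (T.ad u) (hc.ad u), ← ls_add, ← ls_add, ← hc.ad,
        ← hc.ad, ← hc.ad]
      congr 1
      simp only [hχ, jc, map_add, LinearMap.add_apply, hi (io A u)]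
      abel)
    (fun x y z w => by rw [← ls_d3 hc.Φ', σ.ls_zero (h2 _ _ _ _)])
    ⟨dn2 (σ.lam b) Θ, fun x => by rw [dn2_apply, hΘ, ls_zero], fun u v w => by
      rw [← sub_eq_zero, ← ls_d2 hc.Φ, ← ls_lin _ S.inc T.inc hc.inc, ← ls_sub]
      have := σ.ls_zero (h3 (io A u) (io A v) (io A w)) b
      rwa [hc.res, hc.res, hc.res] at this⟩
  choose ψ hψa hψi hψ using this
  refine ⟨re2 σ.v (fun b x y => ψ b x y), re2_mem σ.hv _, re2_alt _ hψa, hc.inv2 _ hψi,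
    fun x y z => ?_⟩
  refine tri_mem (K := K) _ (f := fun x y z => χ x y z - d2 (fun a b => S.Φ' a b)
    (fun a b => re2 σ.v (fun b x y => ψ b x y) a b) x y z)
    (fun y z => ⟨?_, ?_⟩) (fun y z => ⟨?_, ?_⟩) (fun x y => ⟨?_, ?_⟩) (fun x y z => ?_) x y z
  · intros; simp only [hχ, jc, d2, map_add, LinearMap.add_apply]; abel
  · intros; simp only [hχ, jc, d2, map_smul, LinearMap.smul_apply, smul_sub, smul_add]
  · intros; simp only [hχ, jc, d2, map_add, LinearMap.add_apply]; abel
  · intros; simp only [hχ, jc, d2, map_smul, LinearMap.smul_apply, smul_sub, smul_add]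
  · intros; simp only [hχ, jc, d2, map_add, LinearMap.add_apply]; abel
  · intros; simp only [hχ, jc, d2, map_smul, LinearMap.smul_apply, smul_sub, smul_add]
  · have := σ.dec (h1 (io A x) (io A y) (io A z))
    simp only [hψ] at this
    rwa [re_d2 hc.Φ']

end lift
end RT

namespace RT
section mk
variable {B : Type} [CommRing B] {m n : ℕ} (hnm : n ≤ m)

/-- the setup attached to a bracket compatible with the decomposition -/
def mkSetup (Φ : Bil B (Fin m → B)) (alt : ∀ x, Φ x x = 0)
    (jac : ∀ x y z, jc (fun a b => Φ a b) x y z = 0)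
    (ideal : ∀ u x, Φ u (incL B m n x) = incL B m n (resL B hnm (Φ u (incL B m n x))))
    (sub : ∀ u v, resL B hnm (Φ (u - incL B m n (resL B hnm u))
      (v - incL B m n (resL B hnm v))) = 0) :
    Setup B (Fin m → B) (Fin n → B) where
  Φ := Φ
  Φ' := (Φ.compl₁₂ (incL B m n) (incL B m n)).compr₂ (resL B hnm)
  inc := incL B m n
  res := resL B hnm
  ad := (Φ.compl₁₂ (LinearMap.id - incL B m n ∘ₗ resL B hnm) (incL B m n)).compr₂ (resL B hnm)
  res_inc := resL_incL hnm
  ad_inc x := by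
    refine LinearMap.ext fun y => ?_
    simp only [LinearMap.compr₂_apply, LinearMap.compl₁₂_apply, LinearMap.sub_apply,
      LinearMap.id_apply, LinearMap.comp_apply]
    rw [resL_incL, sub_self]; simp only [map_zero, LinearMap.zero_apply]
  alt := alt
  alt' x := by simp only [LinearMap.compr₂_apply, LinearMap.compl₁₂_apply, alt, map_zero]
  jac := jac
  res_Φ u v := by
    have := sub u v
    simp only [LinearMap.compr₂_apply, LinearMap.compl₁₂_apply, LinearMap.sub_apply,
      LinearMap.id_apply, LinearMap.comp_apply]
    rw [anti alt (v - _), ← sub_eq_zero, ← this]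
    simp only [map_sub, LinearMap.sub_apply, map_neg]
    abel
  Φ_inc u x := by
    rw [ideal]
    congr 1
    simp only [LinearMap.compr₂_apply, LinearMap.compl₁₂_apply, LinearMap.sub_apply,
      LinearMap.id_apply, LinearMap.comp_apply, map_sub]
    abel

variable {hnm} {S : Setup B (Fin m → B) (Fin n → B)} (hinc : S.inc = incL B m n)

lemma single_inc {l : Fin m} (hl : (l : ℕ) < n) :
    (Pi.single l 1 : Fin m → B) = incL B m n (Pi.single ⟨l, hl⟩ 1) := by
  ext k
  simp only [incL_apply, inclFun, Pi.single_apply, Fin.ext_iff]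
  split_ifs <;> first | rfl | omega

lemma single_res {l : Fin m} (hl : n ≤ (l : ℕ)) :
    resL B hnm (Pi.single l 1 : Fin m → B) = 0 := by
  ext k
  simp only [resL_apply, restFun, Pi.single_apply, Fin.ext_iff, Fin.val_castLE, Pi.zero_apply]
  rw [if_neg]; omega

include hinc

lemma ad_zero {l : Fin m} (hl : (l : ℕ) < n) : S.ad (Pi.single l 1) = 0 := by
  rw [single_inc hl, ← hinc, S.ad_inc]

lemma inv1_of {t : (Fin n → B) →ₗ[B] (Fin n → B)}
    (h : ∀ l : Fin m, n ≤ (l : ℕ) → ∀ x, S.ad (Pi.single l 1) (t x) = t (S.ad (Pi.single l 1) x)) :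
    S.Inv1 t := by
  intro u x
  rw [pi_eq_sum_univ' u]
  simp only [map_sum, map_smul, LinearMap.sum_apply, LinearMap.smul_apply]
  refine Finset.sum_congr rfl fun l _ => ?_
  rcases Nat.lt_or_ge l n with hl | hl
  · simp [ad_zero hinc hl]
  · rw [h l hl]

lemma inv2_of {f : Bil B (Fin n → B)}
    (h : ∀ l : Fin m, n ≤ (l : ℕ) → ∀ x y, S.ad (Pi.single l 1) (f x y)
      = f (S.ad (Pi.single l 1) x) y + f x (S.ad (Pi.single l 1) y)) :
    S.Inv2 f := by
  intro u x y
  rw [pi_eq_sum_univ' u]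
  simp only [map_sum, map_smul, LinearMap.sum_apply, LinearMap.smul_apply]
  rw [← Finset.sum_add_distrib]
  refine Finset.sum_congr rfl fun l _ => ?_
  rcases Nat.lt_or_ge l n with hl | hl
  · simp [ad_zero hinc hl]
  · rw [h l hl, smul_add]

end mk

section scal
variable {A : Type} [CommRing A] {I : Ideal A} {K : Type} [Field K] [Algebra K A]
  {m n : ℕ} (hnm : n ≤ m) (φ : Bil K (Fin m → K)) (alt : ∀ x, φ x x = 0)
    (jac : ∀ x y z, jc (fun a b => φ a b) x y z = 0)
    (ideal : ∀ u x, φ u (incL K m n x) = incL K m n (resL K hnm (φ u (incL K m n x))))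
    (sub : ∀ u v, resL K hnm (φ (u - incL K m n (resL K hnm u))
      (v - incL K m n (resL K hnm v))) = 0)

lemma ioi (x : Fin n → K) : incL A m n (io A x) = io A (incL K m n x) := (io_inc x).symm
lemma ior (x : Fin m → K) : resL A hnm (io A x) = io A (resL K hnm x) := rfl

include alt in
lemma extA_alt [CharZero K] (x : Fin m → A) : ext2 A (fun a b => φ a b) x x = 0 :=
  alt_ext (K := K) (fun x y => by rw [ext2_io, ext2_io, anti alt, io_neg]) x

include jac in
lemma extA_jac (x y z : Fin m → A) :
    jc (fun a b => ext2 A (fun a b => φ a b) a b) x y z = 0 := by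
  rw [← Submodule.mem_bot A]
  refine tri_mem (K := K) ⊥ (f := jc (fun a b => ext2 A (fun a b => φ a b) a b))
    (fun y z => ⟨?_, ?_⟩) (fun y z => ⟨?_, ?_⟩) (fun x y => ⟨?_, ?_⟩) (fun x y z => ?_) x y z
  · intros; simp only [jc, map_add, LinearMap.add_apply]; abel
  · intros; simp only [jc, map_smul, LinearMap.smul_apply, smul_add]
  · intros; simp only [jc, map_add, LinearMap.add_apply]; abel
  · intros; simp only [jc, map_smul, LinearMap.smul_apply, smul_add]
  · intros; simp only [jc, map_add, LinearMap.add_apply]; abel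
  · intros; simp only [jc, map_smul, LinearMap.smul_apply, smul_add]
  · have := jac x y z
    simp only [jc] at this ⊢
    simp only [ext2_io, ← io_add, this, io_zero, Submodule.zero_mem]

include ideal in
lemma extA_ideal (u : Fin m → A) (x : Fin n → A) :
    ext2 A (fun a b => φ a b) u (incL A m n x)
      = incL A m n (resL A hnm (ext2 A (fun a b => φ a b) u (incL A m n x))) := by
  rw [← sub_eq_zero, ← Submodule.mem_bot A]
  refine bil_mem (K := K) ⊥ (f := fun u x => ext2 A (fun a b => φ a b) u (incL A m n x)
      - incL A m n (resL A hnm (ext2 A (fun a b => φ a b) u (incL A m n x))))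
    (fun y => ⟨?_, ?_⟩) (fun y => ⟨?_, ?_⟩) (fun x y => ?_) u x
  · intros; simp only [map_add, LinearMap.add_apply]; abel
  · intros; simp only [map_smul, LinearMap.smul_apply, smul_sub]
  · intros; simp only [map_add]; abel
  · intros; simp only [map_smul, smul_sub]
  · simp only [ioi, ext2_io, ior]
    rw [← ideal, sub_self]; exact Submodule.zero_mem _

include sub in
lemma extA_sub (u v : Fin m → A) :
    resL A hnm (ext2 A (fun a b => φ a b) (u - incL A m n (resL A hnm u))
      (v - incL A m n (resL A hnm v))) = 0 := by
  rw [← Submodule.mem_bot A]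
  refine bil_mem (K := K) ⊥ (f := fun u v => resL A hnm (ext2 A (fun a b => φ a b)
      (u - incL A m n (resL A hnm u)) (v - incL A m n (resL A hnm v))))
    (fun y => ⟨?_, ?_⟩) (fun y => ⟨?_, ?_⟩) (fun x y => ?_) u v
  · intros; simp only [map_add, map_sub, LinearMap.add_apply, LinearMap.sub_apply]; abel
  · intros; simp only [map_smul, map_sub, LinearMap.sub_apply, LinearMap.smul_apply, smul_sub]
  · intros; simp only [map_add, map_sub, LinearMap.sub_apply]; abel
  · intros; simp only [map_smul, map_sub, LinearMap.sub_apply, smul_sub]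
  · simp only [ior, ioi, ← io_sub, ext2_io, sub, io_zero, Submodule.zero_mem]

lemma mk_cpt (a1 a2 a3 a4) :
    Cpt (mkSetup hnm φ alt jac ideal sub)
      (mkSetup hnm (ext2 A (fun a b => φ a b)) a1 a2 a3 a4) where
  Φ x y := ext2_io φ x y
  Φ' x y := by
    simp only [mkSetup, LinearMap.compr₂_apply, LinearMap.compl₁₂_apply, ioi, ext2_io, ior]
  ad x y := by
    simp only [mkSetup, LinearMap.compr₂_apply, LinearMap.compl₁₂_apply, LinearMap.sub_apply,
      LinearMap.id_apply, LinearMap.comp_apply]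
    rw [ior, ioi, ioi, ← io_sub, ext2_io, ior]
  inc x := ioi x
  res x := rfl

/-- `matMap` as a linear map -/
def mm {p : ℕ} (W : Fin p → Fin p → A) : (Fin p → A) →ₗ[A] (Fin p → A) where
  toFun := matMap W
  map_add' x y := by
    ext k; simp only [matMap, Pi.add_apply, mul_add, Finset.sum_add_distrib]; ring
  map_smul' a x := by
    ext k
    simp only [matMap, Pi.smul_apply, smul_eq_mul, RingHom.id_apply, mul_add, Finset.mul_sum]
    congr 1
    exact Finset.sum_congr rfl fun _ _ => by ring

lemma mm_apply {p : ℕ} (W : Fin p → Fin p → A) (x : Fin p → A) : mm W x = matMap W x := rfl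

lemma mm_V {p : ℕ} {W : Fin p → Fin p → A} (hW : ∀ i j, W i j ∈ I) (x : Fin p → A) :
    mm W x - x ∈ V I (Fin p → A) 1 := by
  rw [mem_V_pi]
  intro i
  rw [mm_apply, Pi.sub_apply, matMap, add_sub_cancel_left, pow_one]
  exact sum_mem fun j _ => I.mul_mem_right _ (hW i j)

lemma exists_mat {p : ℕ} (s : (Fin p → A) →ₗ[A] (Fin p → A))
    (hs : ∀ x, s x - x ∈ V I (Fin p → A) 1) :
    ∃ W : Fin p → Fin p → A, (∀ i j, W i j ∈ I) ∧ ∀ x, matMap W x = s x := by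
  refine ⟨fun k j => (s (Pi.single j 1) - Pi.single j 1 : Fin p → A) k, fun i j => ?_, fun x => ?_⟩
  · have := (mem_V_pi _).1 (hs (Pi.single j 1)) i
    rwa [pow_one] at this
  · have e : s x - x = ∑ j, x j • (s (Pi.single j 1) - Pi.single j 1) := by
      conv_lhs => rw [pi_eq_sum_univ' x, map_sum, ← Finset.sum_sub_distrib]
      exact Finset.sum_congr rfl fun j _ => by rw [map_smul, smul_sub]
    ext k
    have e2 := congrFun e k
    rw [Pi.sub_apply, Finset.sum_apply] at e2
    rw [matMap, sub_eq_iff_eq_add'.1 e2]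
    exact congrArg _ (Finset.sum_congr rfl fun j _ => by
      rw [Pi.smul_apply, smul_eq_mul, mul_comm])

/-- the reduction condition, in terms of the adic filtration -/
lemma red_iff {p : ℕ} (pr : A →ₐ[K] K) (hpr : ∀ a, a ∈ I ↔ pr a = 0)
    (ψ Φ : Bil A (Fin p → A)) (β : (Fin p → K) → (Fin p → K) → (Fin p → K))
    (hΦ : ∀ x y, Φ (io A x) (io A y) = io A (β x y)) :
    (∀ i j k : Fin p, pr (ψ (Pi.single i 1) (Pi.single j 1) k)
        = β (Pi.single i 1) (Pi.single j 1) k) ↔ ∀ x y, ψ x y - Φ x y ∈ V I (Fin p → A) 1 := by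
  have key : ∀ i j k, (ψ (Pi.single i 1) (Pi.single j 1) - Φ (Pi.single i 1) (Pi.single j 1)) k ∈ I
      ↔ pr (ψ (Pi.single i 1) (Pi.single j 1) k) = β (Pi.single i 1) (Pi.single j 1) k := by
    intro i j k
    rw [hpr, Pi.sub_apply, map_sub, sub_eq_zero, ← io_single (K := K) i, ← io_single (K := K) j,
      hΦ, io_single, io_single]
    simp [io]
  constructor
  · intro h x y
    have e : ψ x y - Φ x y = (ψ - Φ) x y := rfl
    rw [e, pi_eq_sum_univ' x, pi_eq_sum_univ' y]
    simp only [map_sum, map_smul, LinearMap.sum_apply, LinearMap.smul_apply]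
    refine sum_mem fun i _ => Submodule.smul_mem _ _ (sum_mem fun j _ =>
      Submodule.smul_mem _ _ ?_)
    rw [mem_V_pi]
    intro k
    rw [pow_one]
    exact (key _ _ _).2 (h _ _ _)
  · intro h i j k
    have := (mem_V_pi _).1 (h (Pi.single i 1) (Pi.single j 1)) k
    rw [pow_one] at this
    exact (key _ _ _).1 this

end scal
end RT

/-- Reduction Theorem, part i.  `g = (K^m, φ₀) = R ⊕ N` with `N = K^n`
an ideal (the first `n` coordinates) and `R` a subalgebra acting semisimply via the
adjoint representation; `φ₀'` is the restricted bracket on `N` and `δ_l = ad(e_l)|_N`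
(`n ≤ l`).  Assume `ī₁` is surjective, `ī₂` bijective and `ī₃` injective.  Then for
every Noetherian complete local `K`-algebra `A` with residue field `K`, the map `𝔍`
is well defined from `R`-invariant deformations of `φ₀'` to deformations of `φ₀`,
and induces a bijection on orbit sets modulo `G_n(A)^R` resp. `G_m(A)`. -/
theorem stmt_0 {K : Type} [Field K] [CharZero K] [IsAlgClosed K] {m n : ℕ}
    (hnm : n ≤ m)
    (φ₀ : (Fin m → K) → (Fin m → K) → (Fin m → K))
    (hbil : IsBilin K φ₀) (halt : ∀ x, φ₀ x x = 0) (hjac : IsJac φ₀)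
    -- `N` is an ideal and `R` a Lie subalgebra
    (hNideal : ∀ x y : Fin m → K, (∀ k : Fin m, n ≤ (k : ℕ) → y k = 0) →
      ∀ k : Fin m, n ≤ (k : ℕ) → φ₀ x y k = 0)
    (hRsub : ∀ x y : Fin m → K, (∀ k : Fin m, (k : ℕ) < n → x k = 0) →
      (∀ k : Fin m, (k : ℕ) < n → y k = 0) → ∀ k : Fin m, (k : ℕ) < n → φ₀ x y k = 0)
    -- `R` acts semisimply on `g` via the adjoint representation
    (hss : ∀ W : Submodule K (Fin m → K),
      (∀ l : Fin m, n ≤ (l : ℕ) → ∀ x ∈ W, φ₀ (Pi.single l 1) x ∈ W) →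
      ∃ W' : Submodule K (Fin m → K), IsCompl W W' ∧
        ∀ l : Fin m, n ≤ (l : ℕ) → ∀ x ∈ W', φ₀ (Pi.single l 1) x ∈ W') :
    -- `φ₀' = φ₀|_{N×N}` and `δ_l = ad_{φ₀}(e_l)|_N`
    ∀ φ₀' : (Fin n → K) → (Fin n → K) → (Fin n → K),
    (∀ x y, φ₀' x y = restFun K n hnm (φ₀ (inclFun K m n x) (inclFun K m n y))) →
    ∀ δK : Fin m → (Fin n → K) → (Fin n → K),
    (∀ (l : Fin m) (x : Fin n → K),
      δK l x = restFun K n hnm (φ₀ (Pi.single l 1) (inclFun K m n x))) →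
    -- hypothesis: `ī₁ : H¹(N,N)^R → H¹(g,g)` is surjective
    (∀ L : (Fin m → K) → (Fin m → K), IsLin K L →
      (∀ x y, L (φ₀ x y) = φ₀ (L x) y + φ₀ x (L y)) →
      ∃ l : (Fin n → K) → (Fin n → K), IsLin K l ∧
        (∀ x y, l (φ₀' x y) = φ₀' (l x) y + φ₀' x (l y)) ∧
        (∀ l' : Fin m, n ≤ (l' : ℕ) → ∀ x, δK l' (l x) = l (δK l' x)) ∧
        ∃ yv : Fin m → K, ∀ v, L v
          = inclFun K m n (l (restFun K n hnm v)) + φ₀ v yv) →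
    -- hypothesis: `ī₂ : H²(N,N)^R → H²(g,g)` is injective
    (∀ ψ : (Fin n → K) → (Fin n → K) → (Fin n → K),
      IsBilin K ψ → (∀ x, ψ x x = 0) →
      (∀ l : Fin m, n ≤ (l : ℕ) → ∀ x y,
        δK l (ψ x y) = ψ (δK l x) y + ψ x (δK l y)) →
      (∀ x y z, d2 φ₀' ψ x y z = 0) →
      (∃ Λ : (Fin m → K) → (Fin m → K), IsLin K Λ ∧ ∀ u v,
        inclFun K m n (ψ (restFun K n hnm u) (restFun K n hnm v)) = d1 φ₀ Λ u v) →
      ∃ l : (Fin n → K) → (Fin n → K), IsLin K l ∧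
        (∀ l' : Fin m, n ≤ (l' : ℕ) → ∀ x, δK l' (l x) = l (δK l' x)) ∧
        ∀ x y, ψ x y = d1 φ₀' l x y) →
    -- hypothesis: `ī₂ : H²(N,N)^R → H²(g,g)` is surjective
    (∀ Ψ : (Fin m → K) → (Fin m → K) → (Fin m → K),
      IsBilin K Ψ → (∀ x, Ψ x x = 0) → (∀ x y z, d2 φ₀ Ψ x y z = 0) →
      ∃ ψ : (Fin n → K) → (Fin n → K) → (Fin n → K),
        IsBilin K ψ ∧ (∀ x, ψ x x = 0) ∧
        (∀ l : Fin m, n ≤ (l : ℕ) → ∀ x y,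
          δK l (ψ x y) = ψ (δK l x) y + ψ x (δK l y)) ∧
        (∀ x y z, d2 φ₀' ψ x y z = 0) ∧
        ∃ Λ : (Fin m → K) → (Fin m → K), IsLin K Λ ∧ ∀ u v, Ψ u v
          = inclFun K m n (ψ (restFun K n hnm u) (restFun K n hnm v)) + d1 φ₀ Λ u v) →
    -- hypothesis: `ī₃ : H³(N,N)^R → H³(g,g)` is injective
    (∀ χ : (Fin n → K) → (Fin n → K) → (Fin n → K) → (Fin n → K),
      IsTrilin K χ → (∀ x y z, (x = y ∨ y = z ∨ x = z) → χ x y z = 0) →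
      (∀ l : Fin m, n ≤ (l : ℕ) → ∀ x y z,
        δK l (χ x y z) = χ (δK l x) y z + χ x (δK l y) z + χ x y (δK l z)) →
      (∀ x y z w, d3 φ₀' χ x y z w = 0) →
      (∃ Ψ : (Fin m → K) → (Fin m → K) → (Fin m → K),
        IsBilin K Ψ ∧ (∀ x, Ψ x x = 0) ∧ ∀ u v w,
          inclFun K m n (χ (restFun K n hnm u) (restFun K n hnm v) (restFun K n hnm w))
            = d2 φ₀ Ψ u v w) →
      ∃ ψ : (Fin n → K) → (Fin n → K) → (Fin n → K),
        IsBilin K ψ ∧ (∀ x, ψ x x = 0) ∧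
        (∀ l : Fin m, n ≤ (l : ℕ) → ∀ x y,
          δK l (ψ x y) = ψ (δK l x) y + ψ x (δK l y)) ∧
        ∀ x y z, χ x y z = d2 φ₀' ψ x y z) →
    -- conclusion, for every Noetherian complete local `K`-algebra `A`
    -- with residue field `K`
    ∀ (A : Type) (_ : CommRing A) (_ : Algebra K A) (_ : IsLocalRing A)
      (_ : IsNoetherianRing A),
    IsAdicComplete (IsLocalRing.maximalIdeal A) A →
    ∀ pr : A →ₐ[K] K, (∀ a : A, a ∈ IsLocalRing.maximalIdeal A ↔ pr a = 0) →
    -- the `A`-linear extensions of the `δ_l`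
    ∀ DlA : Fin m → (Fin n → A) → (Fin n → A),
    (∀ l : Fin m, n ≤ (l : ℕ) → ∀ (w : Fin n → A) (i : Fin n),
      DlA l w i = ∑ j : Fin n, algebraMap K A (δK l (Pi.single j 1) i) * w j) →
    -- the base change `Φ₀` of `φ₀` and the map `𝔍`
    ∀ Φ₀ : (Fin m → A) → (Fin m → A) → (Fin m → A),
    (∀ (u v : Fin m → A) (k : Fin m), Φ₀ u v k = ∑ i : Fin m, ∑ j : Fin m,
      u i * v j * algebraMap K A (φ₀ (Pi.single i 1) (Pi.single j 1) k)) →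
    ∀ Jmap : ((Fin n → A) → (Fin n → A) → (Fin n → A)) →
      ((Fin m → A) → (Fin m → A) → (Fin m → A)),
    (∀ φ u v, Jmap φ u v =
      Φ₀ (u - inclFun A m n (restFun A n hnm u)) (v - inclFun A m n (restFun A n hnm v))
      + Φ₀ (u - inclFun A m n (restFun A n hnm u)) (inclFun A m n (restFun A n hnm v))
      + Φ₀ (inclFun A m n (restFun A n hnm u)) (v - inclFun A m n (restFun A n hnm v))
      + inclFun A m n (φ (restFun A n hnm u) (restFun A n hnm v))) →
    -- `R`-invariant deformations of `φ₀'` and deformations of `φ₀`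
    ∀ RInvDef : ((Fin n → A) → (Fin n → A) → (Fin n → A)) → Prop,
    (∀ φ, RInvDef φ ↔ (IsBilin A φ ∧ (∀ x, φ x x = 0) ∧ IsJac φ ∧
      (∀ i j k : Fin n, pr (φ (Pi.single i 1) (Pi.single j 1) k)
        = φ₀' (Pi.single i 1) (Pi.single j 1) k) ∧
      (∀ l : Fin m, n ≤ (l : ℕ) → ∀ x y,
        DlA l (φ x y) = φ (DlA l x) y + φ x (DlA l y)))) →
    ∀ IsDefm : ((Fin m → A) → (Fin m → A) → (Fin m → A)) → Prop,
    (∀ Ψ, IsDefm Ψ ↔ (IsBilin A Ψ ∧ (∀ x, Ψ x x = 0) ∧ IsJac Ψ ∧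
      (∀ i j k : Fin m, pr (Ψ (Pi.single i 1) (Pi.single j 1) k)
        = φ₀ (Pi.single i 1) (Pi.single j 1) k))) →
    -- the equivalences under `G_m(A)` and under `G_n(A)^R`
    ∀ equivM : ((Fin m → A) → (Fin m → A) → (Fin m → A)) →
        ((Fin m → A) → (Fin m → A) → (Fin m → A)) → Prop,
    (∀ Ψ Ψ', equivM Ψ Ψ' ↔ ∃ W : Fin m → Fin m → A,
      (∀ i j, W i j ∈ IsLocalRing.maximalIdeal A) ∧
      Function.Bijective (matMap W) ∧
      ∀ x y, Ψ' (matMap W x) (matMap W y) = matMap W (Ψ x y)) →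
    ∀ equivN : ((Fin n → A) → (Fin n → A) → (Fin n → A)) →
        ((Fin n → A) → (Fin n → A) → (Fin n → A)) → Prop,
    (∀ φ φ', equivN φ φ' ↔ ∃ W : Fin n → Fin n → A,
      (∀ i j, W i j ∈ IsLocalRing.maximalIdeal A) ∧
      (∀ l : Fin m, n ≤ (l : ℕ) → ∀ x, matMap W (DlA l x) = DlA l (matMap W x)) ∧
      Function.Bijective (matMap W) ∧
      ∀ x y, φ' (matMap W x) (matMap W y) = matMap W (φ x y)) →
    -- `𝔍` is well defined and induces a bijection on orbit sets
    ((∀ φ, RInvDef φ → IsDefm (Jmap φ)) ∧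
      (∀ φ φ', RInvDef φ → RInvDef φ' →
        (equivN φ φ' ↔ equivM (Jmap φ) (Jmap φ'))) ∧
      (∀ Ψ, IsDefm Ψ → ∃ φ, RInvDef φ ∧ equivM (Jmap φ) Ψ)) := by
  intro φ₀' hφ₀' δK hδK H1 H2i H2s H3 A _ _ _ _ hcomp pr hpr DlA hDlA Φ₀ hΦ₀ Jmap hJ RInvDef hR
    IsDefm hDf equivM hM equivN hN
  set I := IsLocalRing.maximalIdeal A with hI
  let φ := RT.toBil hbil
  have alt : ∀ x, φ x x = 0 := halt
  have jac : ∀ x y z, RT.jc (fun a b => φ a b) x y z = 0 := hjac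
  have ideal : ∀ u x, φ u (RT.incL K m n x)
      = RT.incL K m n (RT.resL K hnm (φ u (RT.incL K m n x))) := by
    intro u x
    ext k
    simp only [RT.incL_apply, RT.resL_apply]
    by_cases hk : (k : ℕ) < n
    · conv_rhs => rw [inclFun, dif_pos hk]
      rfl
    · conv_rhs => rw [inclFun, dif_neg hk]
      refine hNideal u _ (fun k hk => ?_) k (by omega)
      rw [inclFun, dif_neg (by omega)]
  have hpR : ∀ (u : Fin m → K) (k : Fin m), (k : ℕ) < n →
      (u - RT.incL K m n (RT.resL K hnm u)) k = 0 := by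
    intro u k hk
    rw [Pi.sub_apply, RT.incL_apply, inclFun, dif_pos hk, sub_eq_zero]; rfl
  have sub : ∀ u v, RT.resL K hnm (φ (u - RT.incL K m n (RT.resL K hnm u))
      (v - RT.incL K m n (RT.resL K hnm v))) = 0 := by
    intro u v
    ext i
    exact hRsub _ _ (hpR u) (hpR v) (Fin.castLE hnm i) i.2
  let T := RT.mkSetup hnm φ alt jac ideal sub
  let S := RT.mkSetup hnm (RT.ext2 A (fun a b => φ a b)) (RT.extA_alt φ alt)
    (RT.extA_jac φ jac) (RT.extA_ideal hnm φ ideal) (RT.extA_sub hnm φ sub)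
  have hc : RT.Cpt T S := RT.mk_cpt hnm φ alt jac ideal sub _ _ _ _
  have hTΦ : (fun a b => T.Φ a b) = φ₀ := rfl
  have hTΦ' : (fun a b => T.Φ' a b) = φ₀' := by
    funext a b; rw [hφ₀']; rfl
  have hTad : ∀ l : Fin m, n ≤ (l : ℕ) → ∀ x, δK l x = T.ad (Pi.single l 1) x := by
    intro l hl x
    have : T.ad (Pi.single l 1) x = RT.resL K hnm (φ (Pi.single l 1
      - RT.incL K m n (RT.resL K hnm (Pi.single l 1))) (RT.incL K m n x)) := rfl
    rw [this, RT.single_res hl, map_zero, sub_zero, hδK]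
    rfl
  have hTinc : T.inc = RT.incL K m n := rfl
  have hSinc : S.inc = RT.incL A m n := rfl
  have hσ := fun k => RT.exists_split (I := I) pr hpr k
  have isLin : ∀ {p : ℕ} (f : (Fin p → K) →ₗ[K] (Fin p → K)), IsLin K (fun x => f x) := by
    intro p f a x y; simp
  -- lifted hypotheses
  have hL1 : S.L1 I := by
    refine hc.L1 hσ fun c hcd => ?_
    obtain ⟨l, hl, -, hli, yv, hy⟩ := H1 (fun x => c x) (isLin c) (fun x y => by
      have := hcd x y
      simp only [d1] at this
      rw [RT.anti T.alt y (c x), sub_neg_eq_add, sub_eq_zero] at this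
      rw [add_comm]
      exact this.symm)
    refine ⟨RT.toL hl, yv, RT.inv1_of hTinc fun l' hl' x => ?_, hy⟩
    rw [← hTad l' hl', ← hTad l' hl']
    exact hli l' hl' x
  have hL2i : S.L2i I := by
    refine hc.L2i hσ fun ψ ha hi hd hΛ => ?_
    obtain ⟨Λ, hΛ⟩ := hΛ
    rw [hTΦ'] at hd
    obtain ⟨l, hl, hli, hlψ⟩ := H2i (fun x y => ψ x y) (RT.isBilin ψ) ha (fun l hl x y => by
      rw [hTad l hl, hTad l hl, hTad l hl, hi]) hd ⟨fun x => Λ x, isLin Λ, hΛ⟩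
    refine ⟨RT.toL hl, RT.inv1_of hTinc fun l' hl' x => ?_, ?_⟩
    · rw [← hTad l' hl', ← hTad l' hl']
      exact hli l' hl' x
    · rw [hTΦ']; exact hlψ
  have hL2s : S.L2s I := by
    refine hc.L2s hσ fun Ψ ha hd => ?_
    obtain ⟨ψ, hb, hψa, hψi, -, Λ, hΛ, h⟩ := H2s (fun x y => Ψ x y) (RT.isBilin Ψ) ha hd
    refine ⟨RT.toBil hb, hψa, RT.inv2_of hTinc fun l' hl' x y => ?_, RT.toL hΛ, h⟩
    rw [← hTad l' hl', ← hTad l' hl', ← hTad l' hl']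
    exact hψi l' hl' x y
  have hL3i : S.L3i I := by
    refine hc.L3i hσ fun χ ht ha hi hd hΨ => ?_
    obtain ⟨Ψ, hΨa, hΨ⟩ := hΨ
    rw [hTΦ'] at hd
    obtain ⟨ψ, hb, hψa, hψi, h⟩ := H3 χ ht ha (fun l hl x y z => by
      rw [hTad l hl, hTad l hl, hTad l hl, hTad l hl, hi]) hd
      ⟨fun x y => Ψ x y, RT.isBilin Ψ, hΨa, hΨ⟩
    refine ⟨RT.toBil hb, hψa, RT.inv2_of hTinc fun l' hl' x y => ?_, ?_⟩
    · rw [← hTad l' hl', ← hTad l' hl', ← hTad l' hl']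
      exact hψi l' hl' x y
    · rw [hTΦ']; exact h
  -- translation of the data over `A`
  have hD : ∀ l : Fin m, n ≤ (l : ℕ) → ∀ x, DlA l x = S.ad (Pi.single l 1) x := by
    intro l hl x
    have e : DlA l x = RT.ext1 A (fun y => T.ad (Pi.single l 1) y) x := by
      ext i
      rw [hDlA l hl]
      simp only [← hTad l hl]
      rfl
    rw [e, ← sub_eq_zero, ← Submodule.mem_bot A]
    refine RT.lin_mem (K := K) ⊥ (f := fun x => RT.ext1 A (fun y => T.ad (Pi.single l 1) y) x
      - S.ad (Pi.single l 1) x) ⟨?_, ?_⟩ (fun x => ?_) x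
    · intros; simp only [map_add]; abel
    · intros; simp only [map_smul, smul_sub]
    · have h1 := RT.ext1_io (A := A) (T.ad (Pi.single l 1)) x
      have h2 := hc.ad (Pi.single l 1) x
      rw [RT.io_single] at h2
      rw [h2, ← h1]
      simp only [sub_self, Submodule.zero_mem]
  have hΦS : ∀ u v, Φ₀ u v = S.Φ u v := by
    intro u v; ext k; rw [hΦ₀]; rfl
  have hJS : ∀ f : RT.Bil A (Fin n → A), Jmap (fun x y => f x y) = fun u v => S.J f u v := by
    intro f
    funext u v
    rw [hJ]
    simp only [hΦS]
    have h3 := S.ΦN (S.res u) (S.res v)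
    have e : S.J f u v = S.Φ u v + (S.inc (f (S.res u) (S.res v))
      - S.inc (S.Φ' (S.res u) (S.res v))) := by
      rw [← map_sub]; rfl
    rw [e, ← h3]
    change S.Φ (u - S.inc (S.res u)) (v - S.inc (S.res v))
      + S.Φ (u - S.inc (S.res u)) (S.inc (S.res v))
      + S.Φ (S.inc (S.res u)) (v - S.inc (S.res v)) + S.inc (f (S.res u) (S.res v)) = _
    simp only [map_sub, LinearMap.sub_apply]
    abel
  have hEc : RT.Comp I (Fin m → A) := RT.comp_pi m
  have hNc : RT.Comp I (Fin n → A) := RT.comp_pi n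
  have hI1 : ∀ t : (Fin n → A) →ₗ[A] (Fin n → A), S.Inv1 t ↔
      ∀ l : Fin m, n ≤ (l : ℕ) → ∀ x, t (DlA l x) = DlA l (t x) := by
    intro t
    constructor
    · intro h l hl x
      rw [hD l hl, hD l hl, h]
    · intro h
      refine RT.inv1_of hSinc fun l hl x => ?_
      rw [← hD l hl, ← hD l hl, h l hl]
  have hR' : ∀ f : RT.Bil A (Fin n → A), RInvDef (fun x y => f x y) ↔
      ((∀ x, f x x = 0) ∧ (∀ x y z, RT.jc (fun a b => f a b) x y z = 0) ∧ S.Inv2 f ∧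
        ∀ x y, f x y - S.Φ' x y ∈ RT.V I (Fin n → A) 1) := by
    intro f
    have hred := RT.red_iff (I := I) pr hpr f S.Φ' φ₀' (fun x y => by rw [hc.Φ', ← hTΦ'])
    rw [hR]
    constructor
    · rintro ⟨-, h1, h2, h3, h4⟩
      refine ⟨h1, h2, RT.inv2_of hSinc fun l hl x y => ?_, hred.1 h3⟩
      rw [← hD l hl, ← hD l hl, ← hD l hl]
      exact h4 l hl x y
    · rintro ⟨h1, h2, h3, h4⟩
      refine ⟨RT.isBilin f, h1, h2, hred.2 h4, fun l hl x y => ?_⟩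
      rw [hD l hl, hD l hl, hD l hl]
      exact h3 _ x y
  have hDf' : ∀ f : RT.Bil A (Fin m → A), IsDefm (fun x y => f x y) ↔
      ((∀ x, f x x = 0) ∧ (∀ x y z, RT.jc (fun a b => f a b) x y z = 0) ∧
        ∀ x y, f x y - S.Φ x y ∈ RT.V I (Fin m → A) 1) := by
    intro f
    have hred := RT.red_iff (I := I) pr hpr f S.Φ φ₀ (fun x y => hc.Φ x y)
    rw [hDf]
    constructor
    · rintro ⟨-, h1, h2, h3⟩
      exact ⟨h1, h2, hred.1 h3⟩
    · rintro ⟨h1, h2, h3⟩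
      exact ⟨RT.isBilin f, h1, h2, hred.2 h3⟩
  have hRb : ∀ f, RInvDef f → ∃ g : RT.Bil A (Fin n → A), f = fun x y => g x y := by
    intro f hf
    exact ⟨RT.toBil ((hR f).1 hf).1, rfl⟩
  have hDb : ∀ f, IsDefm f → ∃ g : RT.Bil A (Fin m → A), f = fun x y => g x y := by
    intro f hf
    exact ⟨RT.toBil ((hDf f).1 hf).1, rfl⟩
  refine ⟨?_, ?_, ?_⟩
  · intro f hf
    obtain ⟨f, rfl⟩ := hRb f hf
    obtain ⟨h1, h2, h3, h4⟩ := (hR' f).1 hf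
    rw [hJS, hDf']
    exact ⟨S.J_alt h1, fun x y z => by rw [S.jc_J h3 h1, h2, map_zero], S.J_V h4⟩
  · intro f f' hf hf'
    obtain ⟨f, rfl⟩ := hRb f hf
    obtain ⟨f', rfl⟩ := hRb f' hf'
    obtain ⟨h1, h2, h3, h4⟩ := (hR' f).1 hf
    obtain ⟨h1', h2', h3', h4'⟩ := (hR' f').1 hf'
    rw [hN, hM, hJS, hJS]
    constructor
    · rintro ⟨W, hW, hWD, -, hWf⟩
      have ht : S.Inv1 (RT.mm W) := (hI1 _).2 hWD
      have hsV : ∀ u, S.ig (RT.mm W) u - u ∈ RT.V I (Fin m → A) 1 := S.ig_V (RT.mm_V hW)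
      obtain ⟨W', hW', hs⟩ := RT.exists_mat (S.ig (RT.mm W)) hsV
      have hs' : matMap W' = S.ig (RT.mm W) := funext hs
      refine ⟨W', hW', ?_, fun x y => ?_⟩
      · rw [hs']; exact RT.unip_bij hEc _ hsV
      · rw [hs']
        exact S.J_ig ht f f' hWf x y
    · rintro ⟨W, hW, -, hWf⟩
      obtain ⟨t, ht, htV, htf⟩ := S.inj K hEc hNc hL1 hL2i f f' h1 h1' h2 h2' h3 h3' h4 h4'
        (RT.mm W) (RT.mm_V hW) hWf
      obtain ⟨W', hW', hs⟩ := RT.exists_mat t htV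
      have hs' : matMap W' = t := funext hs
      refine ⟨W', hW', ?_, ?_, ?_⟩
      · rw [hs']; exact (hI1 t).1 ht
      · rw [hs']; exact RT.unip_bij hNc _ htV
      · rw [hs']; exact htf
  · intro Ψ hΨ
    obtain ⟨Ψ, rfl⟩ := hDb Ψ hΨ
    obtain ⟨h1, h2, h3⟩ := (hDf' Ψ).1 hΨ
    obtain ⟨f, a1, a2, a3, a4, s, hs, hsΨ⟩ := S.surj hEc hNc hL2s hL3i Ψ h1 h2 h3
    refine ⟨fun x y => f x y, (hR' f).2 ⟨a1, a2, a3, a4⟩, ?_⟩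
    rw [hM, hJS]
    obtain ⟨W', hW', hs1⟩ := RT.exists_mat s hs
    have hs' : matMap W' = s := funext hs1
    refine ⟨W', hW', ?_, ?_⟩
    · rw [hs']; exact RT.unip_bij hEc _ hs
    · rw [hs']; exact hsΨ

end Stmt0
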